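/- arXiv:1210.7485 — 8 statements merged into one kernel-verified Lean document; each statement's English description precedes it below -/
import Mathlib

section
/- Let n ≥ 1 and let A be an n×n real matrix all of whose entries a_{ij} are strictly positive. Then there exist vectors d¹, d² ∈ ℝⁿ with strictly positive entries such that for every i, Σ_{j=1}^{n} d¹_i d²_j a_{ij} = 1/n, and for every j, Σ_{i=1}^{n} d¹_i d²_j a_{ij} = 1/n; that is, the matrix P with entries p_{ij} = d¹_i d²_j a_{ij} is a discrete doubly stochastic scaling of A with uniform marginals. -/
section SinkhornScaling

variable {ι : Type*} [Fintype ι]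

/-- The ratio `∏ xⱼ / ∏ (A x)ᵢ`, whose maximizers on the positive orthant give scalings of `A`. -/
noncomputable def sinkhornRatio (A : ι → ι → ℝ) (x : ι → ℝ) : ℝ :=
  (∏ j, x j) / ∏ i, ∑ j, A i j * x j

lemma sinkhornRatio_smul (A : ι → ι → ℝ) (x : ι → ℝ) {c : ℝ} (hc : c ≠ 0) :
    sinkhornRatio A (c • x) = sinkhornRatio A x := by
  have h : ∀ i, ∑ j, A i j * (c * x j) = c * ∑ j, A i j * x j := fun i => by
    rw [Finset.mul_sum]
    exact Finset.sum_congr rfl fun j _ => by ring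
  simp only [sinkhornRatio, Pi.smul_apply, smul_eq_mul, h, Finset.prod_mul_distrib]
  exact mul_div_mul_left _ _ (Finset.prod_ne_zero_iff.mpr fun _ _ => hc)

lemma sum_mul_pos_of_mem_stdSimplex {a x : ι → ℝ} (ha : ∀ j, 0 < a j)
    (hx : x ∈ stdSimplex ℝ ι) : 0 < ∑ j, a j * x j := by
  have hnonneg : ∀ j ∈ Finset.univ, 0 ≤ a j * x j := fun j _ => mul_nonneg (ha j).le (hx.1 j)
  refine (Finset.sum_nonneg hnonneg).lt_of_ne' fun h => ?_
  have hzero : ∀ j, x j = 0 := fun j =>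
    (mul_eq_zero.mp ((Finset.sum_eq_zero_iff_of_nonneg hnonneg).mp h j
      (Finset.mem_univ j))).resolve_left (ha j).ne'
  simpa [hzero] using hx.2

lemma sum_mul_pos [Nonempty ι] {a x : ι → ℝ} (ha : ∀ j, 0 < a j) (hx : ∀ j, 0 < x j) :
    0 < ∑ j, a j * x j :=
  Finset.sum_pos (fun j _ => mul_pos (ha j) (hx j)) Finset.univ_nonempty

lemma sinkhornRatio_pos [Nonempty ι] {A : ι → ι → ℝ} (hA : ∀ i j, 0 < A i j) {x : ι → ℝ}
    (hx : ∀ j, 0 < x j) : 0 < sinkhornRatio A x :=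
  div_pos (Finset.prod_pos fun j _ => hx j) (Finset.prod_pos fun i _ => sum_mul_pos (hA i) hx)

lemma exists_pos_forall_sinkhornRatio_le [Nonempty ι] {A : ι → ι → ℝ} (hA : ∀ i j, 0 < A i j) :
    ∃ x : ι → ℝ, (∀ j, 0 < x j) ∧
      ∀ y : ι → ℝ, (∀ j, 0 < y j) → sinkhornRatio A y ≤ sinkhornRatio A x := by
  classical
  have hcont : ContinuousOn (sinkhornRatio A) (stdSimplex ℝ ι) := by
    refine ContinuousOn.div (by fun_prop) (by fun_prop) fun x hx => ?_
    exact Finset.prod_ne_zero_iff.mpr fun i _ => (sum_mul_pos_of_mem_stdSimplex (hA i) hx).ne'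
  obtain ⟨x, hx, hmax⟩ := (isCompact_stdSimplex (𝕜 := ℝ) ι).exists_isMaxOn
    ⟨_, single_mem_stdSimplex ℝ (Classical.arbitrary ι)⟩ hcont
  have hle : ∀ y : ι → ℝ, (∀ j, 0 < y j) → sinkhornRatio A y ≤ sinkhornRatio A x := by
    intro y hy
    have hs : 0 < ∑ j, y j := Finset.sum_pos (fun j _ => hy j) Finset.univ_nonempty
    rw [← sinkhornRatio_smul A y (inv_ne_zero hs.ne')]
    refine hmax ⟨fun j => (mul_pos (inv_pos.mpr hs) (hy j)).le, ?_⟩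
    simp only [Pi.smul_apply, smul_eq_mul, ← Finset.mul_sum]
    exact inv_mul_cancel₀ hs.ne'
  refine ⟨x, fun j => (hx.1 j).lt_of_ne' fun hj => ?_, hle⟩
  have hpos : 0 < sinkhornRatio A x :=
    (sinkhornRatio_pos hA fun _ => one_pos).trans_le (hle (fun _ => 1) fun _ => one_pos)
  rw [sinkhornRatio, Finset.prod_eq_zero (Finset.mem_univ j) hj, zero_div] at hpos
  exact hpos.false

lemma log_sinkhornRatio [Nonempty ι] {A : ι → ι → ℝ} (hA : ∀ i j, 0 < A i j) {x : ι → ℝ}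
    (hx : ∀ j, 0 < x j) : Real.log (sinkhornRatio A x) =
      ∑ j, Real.log (x j) - ∑ i, Real.log (∑ j, A i j * x j) := by
  rw [sinkhornRatio, Real.log_div, Real.log_prod, Real.log_prod]
  · exact fun i _ => (sum_mul_pos (hA i) hx).ne'
  · exact fun j _ => (hx j).ne'
  · exact Finset.prod_ne_zero_iff.mpr fun j _ => (hx j).ne'
  · exact Finset.prod_ne_zero_iff.mpr fun i _ => ne_of_gt (sum_mul_pos (hA i) hx)

/-- First-order optimality condition at a maximizer of `sinkhornRatio`. -/
lemma sum_div_eq_inv_of_forall_sinkhornRatio_le [Nonempty ι] {A : ι → ι → ℝ}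
    (hA : ∀ i j, 0 < A i j) {x : ι → ℝ} (hx : ∀ j, 0 < x j)
    (hmax : ∀ y : ι → ℝ, (∀ j, 0 < y j) → sinkhornRatio A y ≤ sinkhornRatio A x) (j : ι) :
    ∑ i, A i j / ∑ k, A i k * x k = (x j)⁻¹ := by
  classical
  set e : ι → ℝ := Pi.single j 1 with he
  let φ : ℝ → ℝ := fun t =>
    ∑ k, Real.log (x k + t * e k) - ∑ i, Real.log (∑ k, A i k * (x k + t * e k))
  have hline : ∀ k, HasDerivAt (fun t : ℝ => x k + t * e k) (e k) 0 := fun k => by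
    simpa using ((hasDerivAt_id (0 : ℝ)).mul_const (e k)).const_add (x k)
  have hderiv : HasDerivAt φ
      (∑ k, e k / x k - ∑ i, (∑ k, A i k * e k) / ∑ k, A i k * x k) 0 := by
    refine HasDerivAt.sub (HasDerivAt.fun_sum fun k _ => ?_) (HasDerivAt.fun_sum fun i _ => ?_)
    · simpa using (hline k).log (by simpa using (hx k).ne')
    · have h : HasDerivAt (fun t : ℝ => ∑ k, A i k * (x k + t * e k)) (∑ k, A i k * e k) 0 :=
        HasDerivAt.fun_sum fun k _ => (hline k).const_mul (A i k)
      simpa using h.log (by simpa using (sum_mul_pos (hA i) hx).ne')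
  have hlocal : IsLocalMax φ 0 := by
    have hev : ∀ᶠ t in nhds (0 : ℝ), ∀ k, 0 < x k + t * e k :=
      Filter.eventually_all.mpr fun k =>
        (hline k).continuousAt.eventually (lt_mem_nhds (by simpa using hx k))
    filter_upwards [hev] with t ht
    have h := Real.log_le_log (sinkhornRatio_pos hA ht) (hmax _ ht)
    rw [log_sinkhornRatio hA ht, log_sinkhornRatio hA hx] at h
    simpa [φ] using h
  have hzero := hlocal.hasDerivAt_eq_zero hderiv
  simp only [he, Pi.single_apply, ite_div, zero_div, mul_ite, mul_one, mul_zero,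
    Finset.sum_ite_eq', Finset.mem_univ, if_true, one_div] at hzero
  linarith

end SinkhornScaling


/-- **Sinkhorn scaling existence.** For any `n ≥ 1` and any `n × n` real matrix `A` with
strictly positive entries, there exist strictly positive vectors `d¹, d²` such that the
matrix with entries `d¹ i * d² j * A i j` has all row sums and all column sums equal
to `1/n` (a discrete doubly stochastic scaling of `A` with uniform marginals). -/
theorem doubly_stochastic_scaling_exists (n : ℕ) (hn : 1 ≤ n)
    (A : Fin n → Fin n → ℝ) (hA : ∀ i j, 0 < A i j) :
    ∃ d1 d2 : Fin n → ℝ,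
      (∀ i, 0 < d1 i) ∧ (∀ j, 0 < d2 j) ∧
      (∀ i, ∑ j, d1 i * d2 j * A i j = 1 / n) ∧
      (∀ j, ∑ i, d1 i * d2 j * A i j = 1 / n) := by
  have : Nonempty (Fin n) := ⟨⟨0, hn⟩⟩
  have hn' : (n : ℝ) ≠ 0 := by exact_mod_cast (Nat.one_le_iff_ne_zero.mp hn)
  obtain ⟨x, hx, hmax⟩ := exists_pos_forall_sinkhornRatio_le hA
  have hs : ∀ i, 0 < ∑ j, A i j * x j := fun i => sum_mul_pos (hA i) hx
  refine ⟨fun i => 1 / (n * ∑ j, A i j * x j), x, fun i => ?_, hx, fun i => ?_, fun j => ?_⟩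
  · have := hs i
    positivity
  · have h : ∀ j, 1 / (n * ∑ j, A i j * x j) * x j * A i j =
        1 / (n * ∑ j, A i j * x j) * (A i j * x j) := fun j => by ring
    simp only [h, ← Finset.mul_sum]
    have := (hs i).ne'
    field_simp
  · have h : ∀ i, 1 / (n * ∑ j, A i j * x j) * x j * A i j =
        x j / n * (A i j / ∑ j, A i j * x j) := fun i => by
      have := (hs i).ne'
      field_simp
    simp only [h, ← Finset.mul_sum]
    rw [sum_div_eq_inv_of_forall_sinkhornRatio_le hA hx hmax j]
    have := (hx j).ne'
    field_simp
end

section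
/- Let A be an n×n real matrix with strictly positive entries, and suppose (d¹, d²) and (e¹, e²) are two pairs of strictly positive vectors in ℝⁿ such that both matrices with entries d¹_i d²_j a_{ij} and e¹_i e²_j a_{ij} have all row sums and all column sums equal to 1/n. Then there exists t > 0 such that e¹_i = t·d¹_i for all i and e²_j = t⁻¹·d²_j for all j; in particular the doubly stochastic scaling d¹_i d²_j a_{ij} is unique. -/
/-- **Uniqueness of the doubly stochastic scaling.** If `(d¹, d²)` and `(e¹, e²)` are two
pairs of strictly positive vectors both scaling the positive matrix `A` to a matrix with all
row and column sums equal to `1/n`, then they differ by a positive scalar `t`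
(`e¹ = t • d¹`, `e² = t⁻¹ • d²`); in particular the scaled matrix itself is unique. -/
theorem doubly_stochastic_scaling_unique (n : ℕ)
    (A : Fin n → Fin n → ℝ) (hA : ∀ i j, 0 < A i j)
    (d1 d2 e1 e2 : Fin n → ℝ)
    (hd1 : ∀ i, 0 < d1 i) (hd2 : ∀ j, 0 < d2 j)
    (he1 : ∀ i, 0 < e1 i) (he2 : ∀ j, 0 < e2 j)
    (hdrow : ∀ i, ∑ j, d1 i * d2 j * A i j = 1 / n)
    (hdcol : ∀ j, ∑ i, d1 i * d2 j * A i j = 1 / n)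
    (herow : ∀ i, ∑ j, e1 i * e2 j * A i j = 1 / n)
    (hecol : ∀ j, ∑ i, e1 i * e2 j * A i j = 1 / n) :
    ∃ t : ℝ, 0 < t ∧ (∀ i, e1 i = t * d1 i) ∧ (∀ j, e2 j = t⁻¹ * d2 j) ∧
      ∀ i j, e1 i * e2 j * A i j = d1 i * d2 j * A i j := by
  rcases isEmpty_or_nonempty (Fin n) with h | h
  · exact ⟨1, one_pos, fun i => h.elim i, fun i => h.elim i, fun i => h.elim i⟩
  obtain ⟨p, hp⟩ := Finite.exists_max fun i => e1 i / d1 i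
  obtain ⟨t, ht⟩ : ∃ t, t = e1 p / d1 p := ⟨_, rfl⟩
  have ht0 : 0 < t := ht ▸ div_pos (he1 p) (hd1 p)
  have htp : e1 p = t * d1 p := by rw [ht, div_mul_cancel₀ _ (hd1 p).ne']
  have hle (i) : e1 i ≤ t * d1 i := by
    rw [ht, ← div_le_iff₀ (hd1 i)]
    exact hp i
  have hS (j) : 0 < ∑ i, d1 i * A i j :=
    Finset.sum_pos (fun i _ => mul_pos (hd1 i) (hA i j)) Finset.univ_nonempty
  have hd2_le (j) : d2 j ≤ t * e2 j := by
    refine le_of_mul_le_mul_right ?_ (hS j)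
    calc d2 j * ∑ i, d1 i * A i j = ∑ i, e1 i * e2 j * A i j := by
          rw [hecol, ← hdcol j, Finset.mul_sum]
          exact Finset.sum_congr rfl fun i _ => by ring
      _ ≤ ∑ i, t * d1 i * e2 j * A i j := Finset.sum_le_sum fun i _ =>
          mul_le_mul_of_nonneg_right
            (mul_le_mul_of_nonneg_right (hle i) (he2 j).le) (hA i j).le
      _ = t * e2 j * ∑ i, d1 i * A i j := by
          rw [Finset.mul_sum]
          exact Finset.sum_congr rfl fun i _ => by ring
  have hd2_eq (j) : d2 j = t * e2 j := by
    have hrow : ∑ j, d1 p * d2 j * A p j = ∑ j, d1 p * (t * e2 j) * A p j := by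
      rw [hdrow, ← herow p, htp]
      exact Finset.sum_congr rfl fun j _ => by ring
    have hterm := (Finset.sum_eq_sum_iff_of_le fun j _ => mul_le_mul_of_nonneg_right
      (mul_le_mul_of_nonneg_left (hd2_le j) (hd1 p).le) (hA p j).le).1 hrow j (Finset.mem_univ j)
    exact mul_left_cancel₀ (hd1 p).ne' (mul_right_cancel₀ (hA p j).ne' hterm)
  have he1_eq (i) : e1 i = t * d1 i := by
    have hcol : ∑ i, e1 i * e2 p * A i p = ∑ i, t * d1 i * e2 p * A i p := by
      rw [hecol, ← hdcol p, hd2_eq p]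
      exact Finset.sum_congr rfl fun i _ => by ring
    have hterm := (Finset.sum_eq_sum_iff_of_le fun i _ => mul_le_mul_of_nonneg_right
      (mul_le_mul_of_nonneg_right (hle i) (he2 p).le) (hA i p).le).1 hcol i (Finset.mem_univ i)
    exact mul_right_cancel₀ (he2 p).ne' (mul_right_cancel₀ (hA i p).ne' hterm)
  refine ⟨t, ht0, he1_eq, fun j => ?_, fun i j => ?_⟩
  · rw [hd2_eq, inv_mul_cancel_left₀ ht0.ne']
  · rw [he1_eq, hd2_eq]
    ring
end

section
/- Let A be an n×n real matrix with strictly positive entries a_{ij}. Starting from an arbitrary strictly positive vector d²⁽⁰⁾ ∈ ℝⁿ, define the iteration d¹⁽ᵏ⁺¹⁾_i = 1/(n·Σ_j a_{ij} d²⁽ᵏ⁾_j) for i = 1,…,n and d²⁽ᵏ⁺¹⁾_j = 1/(n·Σ_i a_{ij} d¹⁽ᵏ⁺¹⁾_i) for j = 1,…,n. Then there exist strictly positive vectors d¹, d² such that the matrix p_{ij} = d¹_i d²_j a_{ij} has all row and column sums equal to 1/n, and the iteration converges geometrically to it: there exist C > 0 and r ∈ (0,1) such that for every k, max_{i,j}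 |d¹⁽ᵏ⁾_i d²⁽ᵏ⁾_j a_{ij} − p_{ij}| ≤ C·rᵏ. -/
open Filter Topology

/-- Averages with weights at least `δ` of numbers in `[m, M]` all lie in a subinterval whose length
is smaller by the factor `1 - card κ * δ`. -/
lemma exists_interval_weighted_average {ι κ : Type*} [Fintype κ] (w : ι → κ → ℝ) (x : κ → ℝ)
    {δ m M : ℝ} (hδ : 0 ≤ δ) (hw : ∀ i j, δ ≤ w i j) (hsum : ∀ i, ∑ j, w i j = 1)
    (hm : ∀ j, m ≤ x j) (hM : ∀ j, x j ≤ M) :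
    ∃ m' M', m ≤ m' ∧ M' - m' = (1 - Fintype.card κ * δ) * (M - m) ∧
      ∀ i, m' ≤ ∑ j, w i j * x j ∧ ∑ j, w i j * x j ≤ M' := by
  have hconst : ∀ i c, ∑ j, (w i j - δ) * c = (1 - Fintype.card κ * δ) * c := by
    intro i c
    rw [← Finset.sum_mul, Finset.sum_sub_distrib, hsum]
    simp
  have hsplit : ∀ i, ∑ j, w i j * x j = δ * ∑ j, x j + ∑ j, (w i j - δ) * x j := by
    intro i
    rw [Finset.mul_sum, ← Finset.sum_add_distrib]
    exact Finset.sum_congr rfl fun j _ => by ring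
  refine ⟨δ * ∑ j, x j + (1 - Fintype.card κ * δ) * m,
    δ * ∑ j, x j + (1 - Fintype.card κ * δ) * M, ?_, by ring, fun i => ⟨?_, ?_⟩⟩
  · have h : (Fintype.card κ : ℝ) * m ≤ ∑ j, x j := by
      simpa using Finset.sum_le_sum fun j (_ : j ∈ Finset.univ) => hm j
    nlinarith
  · rw [hsplit, ← hconst i]
    gcongr with j
    · linarith [hw i j]
    · exact hm j
  · rw [hsplit, ← hconst i]
    gcongr with j
    · linarith [hw i j]
    · exact hM j

/-- A weighted average of numbers in `[m, M]` lies in `[m, M]`. -/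
lemma weighted_average_mem_Icc {κ : Type*} [Fintype κ] (w x : κ → ℝ) {m M : ℝ}
    (hw : ∀ j, 0 ≤ w j) (hsum : ∑ j, w j = 1) (hx : ∀ j, x j ∈ Set.Icc m M) :
    ∑ j, w j * x j ∈ Set.Icc m M := by
  constructor
  · calc m = ∑ j, w j * m := by rw [← Finset.sum_mul, hsum, one_mul]
      _ ≤ _ := Finset.sum_le_sum fun j _ => mul_le_mul_of_nonneg_left (hx j).1 (hw j)
  · calc _ ≤ ∑ j, w j * M :=
        Finset.sum_le_sum fun j _ => mul_le_mul_of_nonneg_left (hx j).2 (hw j)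
      _ = M := by rw [← Finset.sum_mul, hsum, one_mul]

lemma abs_log_le_of_abs_sub_one_le {m t ε : ℝ} (hm : 0 < m) (hm1 : m ≤ 1) (hmt : m ≤ t)
    (h : |t - 1| ≤ ε) : |Real.log t| ≤ ε / m := by
  have ht : 0 < t := hm.trans_le hmt
  have hε : 0 ≤ ε := (abs_nonneg _).trans h
  rw [abs_le] at h ⊢
  have hεm : ε ≤ ε / m := le_div_self hε hm hm1
  constructor
  · have h1 := Real.one_sub_inv_le_log_of_pos ht
    have h2 : t⁻¹ - 1 ≤ ε / m := by
      calc t⁻¹ - 1 = (1 - t) / t := by field_simp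
        _ ≤ ε / t := by gcongr; linarith
        _ ≤ ε / m := by gcongr
    linarith
  · linarith [Real.log_le_sub_one_of_pos ht]

lemma abs_exp_sub_exp_le (s t : ℝ) :
    |Real.exp s - Real.exp t| ≤ Real.exp t * (|s - t| * Real.exp |s - t|) := by
  set h := s - t with hh
  have hs : Real.exp s - Real.exp t = Real.exp t * (Real.exp h - 1) := by
    rw [mul_sub, ← Real.exp_add, hh]; ring_nf
  rw [hs, abs_mul, abs_of_pos (Real.exp_pos t)]
  gcongr
  have h1 : 1 ≤ Real.exp |h| := Real.one_le_exp (abs_nonneg h)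
  rw [abs_le]
  constructor
  · nlinarith [Real.add_one_le_exp h, neg_abs_le h, abs_nonneg h]
  · have h2 : 1 - h ≤ Real.exp (-h) := by linarith [Real.add_one_le_exp (-h)]
    have h3 : Real.exp h * Real.exp (-h) = 1 := by rw [← Real.exp_add]; simp
    have h4 : Real.exp h - 1 ≤ h * Real.exp h := by nlinarith [Real.exp_pos h]
    have h5 : h * Real.exp h ≤ |h| * Real.exp h := by
      gcongr; exact le_abs_self h
    have h6 : |h| * Real.exp h ≤ |h| * Real.exp |h| := by
      gcongr; exact le_abs_self h
    linarith

/-- A real sequence with geometrically small increments converges geometrically. -/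
lemma exists_limit_of_geometric_increments {C r : ℝ} (hr1 : r < 1) {z : ℕ → ℝ}
    (hz : ∀ k, |z (k + 1) - z k| ≤ C * r ^ k) :
    ∃ L, Tendsto z atTop (𝓝 L) ∧ ∀ k, |z k - L| ≤ C / (1 - r) * r ^ k := by
  have hd : ∀ k, dist (z k) (z (k + 1)) ≤ C * r ^ k := fun k => by
    rw [dist_comm, Real.dist_eq]; exact hz k
  obtain ⟨L, hL⟩ := cauchySeq_tendsto_of_complete (cauchySeq_of_le_geometric r C hr1 hd)
  refine ⟨L, hL, fun k => ?_⟩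
  have := dist_le_of_le_geometric_of_tendsto r C hr1 hd hL k
  rw [Real.dist_eq] at this
  exact this.trans_eq (by ring)

/-- A geometric bound valid from index `2` on holds, with another constant, from index `0` on. -/
lemma exists_geometric_bound_of_shift {ι : Type*} [Fintype ι] {C r : ℝ} (hr : 0 < r)
    (F : ℕ → ι → ℝ) (hF : ∀ k i, |F (k + 2) i| ≤ C * r ^ k) :
    ∃ C', 0 < C' ∧ ∀ k i, |F k i| ≤ C' * r ^ k := by
  have hle : ∀ k i, |F k i| ≤ ∑ i, |F k i| := fun k i =>
    Finset.single_le_sum (f := fun i => |F k i|) (fun _ _ => abs_nonneg _) (Finset.mem_univ i)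
  have h0 : 0 ≤ ∑ i, |F 0 i| := Finset.sum_nonneg fun _ _ => abs_nonneg _
  have h1 : 0 ≤ (∑ i, |F 1 i|) / r := by positivity
  have h2 : 0 ≤ |C| / r ^ 2 := by positivity
  refine ⟨|C| / r ^ 2 + (∑ i, |F 0 i|) + (∑ i, |F 1 i|) / r + 1, by positivity, ?_⟩
  rintro (_ | _ | k) i
  · simpa using (hle 0 i).trans (by linarith)
  · calc |F 1 i| ≤ (∑ i, |F 1 i|) / r * r := by rw [div_mul_cancel₀ _ hr.ne']; exact hle 1 i
      _ ≤ _ := by rw [zero_add, pow_one]; gcongr; linarith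
  · calc |F (k + 2) i| ≤ |C| * r ^ k :=
        (hF k i).trans (by gcongr; exact le_abs_self C)
      _ = |C| / r ^ 2 * r ^ (k + 2) := by rw [pow_add]; field_simp
      _ ≤ _ := by gcongr; linarith

section Scaling

variable {n : ℕ} {A : Fin n → Fin n → ℝ} {x y : ℕ → Fin n → ℝ}

/-- If `x` is obtained by column normalisation, then the row-normalised matrix built from `x` has
entries bounded below in terms of bounds on `A` only. -/
lemma row_normalized_entry_lower_bound {a b : ℝ} (hn : 1 ≤ n) (ha : 0 < a)
    (hAa : ∀ i j, a ≤ A i j) (hAb : ∀ i j, A i j ≤ b) {p q : Fin n → ℝ} (hp : ∀ i, 0 < p i)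
    (hq : ∀ j, q j = 1 / (n * ∑ i, A i j * p i)) (i j : Fin n) :
    (a / b) ^ 2 / n ≤ A i j * q j / ∑ l, A i l * q l := by
  have : Nonempty (Fin n) := ⟨i⟩
  have hn0 : (0 : ℝ) < n := by exact_mod_cast hn
  have hb : 0 < b := ha.trans_le ((hAa i j).trans (hAb i j))
  set S := ∑ i, p i
  have hS : 0 < S := Finset.sum_pos (fun i _ => hp i) Finset.univ_nonempty
  have hlow : ∀ j, a * S ≤ ∑ i, A i j * p i := fun j => by
    rw [Finset.mul_sum]
    exact Finset.sum_le_sum fun i _ => mul_le_mul_of_nonneg_right (hAa i j) (hp i).le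
  have hup : ∀ j, ∑ i, A i j * p i ≤ b * S := fun j => by
    rw [Finset.mul_sum]
    exact Finset.sum_le_sum fun i _ => mul_le_mul_of_nonneg_right (hAb i j) (hp i).le
  have hcol : ∀ j, 0 < ∑ i, A i j * p i := fun j => (mul_pos ha hS).trans_le (hlow j)
  have hq0 : ∀ j, 0 < q j := fun j => by rw [hq]; have := hcol j; positivity
  have hqlow : ∀ j, 1 / (n * (b * S)) ≤ q j := fun j => by
    rw [hq]; have := hcol j; gcongr; exact hup j
  have hqup : ∀ j, q j ≤ 1 / (n * (a * S)) := fun j => by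
    rw [hq]; gcongr; exact hlow j
  have hpos : 0 < ∑ l, A i l * q l :=
    Finset.sum_pos (fun l _ => mul_pos (ha.trans_le (hAa i l)) (hq0 l)) Finset.univ_nonempty
  have hden : ∑ l, A i l * q l ≤ b / (a * S) := by
    calc ∑ l, A i l * q l ≤ ∑ _l : Fin n, b * (1 / (n * (a * S))) :=
          Finset.sum_le_sum fun l _ => mul_le_mul (hAb i l) (hqup l) (hq0 l).le hb.le
      _ = b / (a * S) := by
          rw [Finset.sum_const, Finset.card_univ, Fintype.card_fin, nsmul_eq_mul]
          field_simp
  calc (a / b) ^ 2 / n = a * (1 / (n * (b * S))) / (b / (a * S)) := by field_simp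
    _ ≤ A i j * q j / ∑ l, A i l * q l := by
        have h := hq0 j
        have h' := ha.trans_le (hAa i j)
        gcongr
        · exact hAa i j
        · exact hqlow j

/-- One full step of the iteration contracts the spread of the ratios of successive iterates. -/
lemma scaling_ratio_contraction {a b : ℝ} (hn : 1 ≤ n) (ha : 0 < a)
    (hAa : ∀ i j, a ≤ A i j) (hAb : ∀ i j, A i j ≤ b)
    (hx0 : ∀ k j, 0 < x k j) (hy0 : ∀ k i, 0 < y k i)
    (hx : ∀ k j, x k j = 1 / (n * ∑ i, A i j * y k i))
    (hy : ∀ k i, y (k + 1) i = 1 / (n * ∑ j, A i j * x k j)) {k : ℕ} {m M : ℝ} (hm0 : 0 < m)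
    (hratio : ∀ j, x (k + 1) j / x k j ∈ Set.Icc m M) :
    ∃ m' M', m ≤ m' ∧ M' - m' = (1 - (a / b) ^ 2) * (M - m) ∧ 1 ∈ Set.Icc m' M' ∧
      (∀ i, y (k + 1) i / y (k + 2) i ∈ Set.Icc m' M') ∧
      ∀ j, x (k + 2) j / x (k + 1) j ∈ Set.Icc m' M' := by
  have hn0 : (0 : ℝ) < n := by exact_mod_cast hn
  have : Nonempty (Fin n) := ⟨⟨0, hn⟩⟩
  have hA : ∀ i j, 0 < A i j := fun i j => ha.trans_le (hAa i j)
  have hrowpos : ∀ k i, 0 < ∑ j, A i j * x k j := fun k i =>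
    Finset.sum_pos (fun j _ => mul_pos (hA i j) (hx0 k j)) Finset.univ_nonempty
  have hcolpos : ∀ k j, 0 < ∑ i, A i j * y k i := fun k j =>
    Finset.sum_pos (fun i _ => mul_pos (hA i j) (hy0 k i)) Finset.univ_nonempty
  obtain ⟨m', M', hmm, hlen, hmem⟩ := exists_interval_weighted_average
    (fun i j => A i j * x k j / ∑ l, A i l * x k l) (fun j => x (k + 1) j / x k j)
    (δ := (a / b) ^ 2 / n) (by positivity)
    (fun i j => row_normalized_entry_lower_bound hn ha hAa hAb (hy0 k) (hx k) i j)
    (fun i => by rw [← Finset.sum_div, div_self (hrowpos k i).ne'])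
    (fun j => (hratio j).1) (fun j => (hratio j).2)
  have hyr : ∀ i, y (k + 1) i / y (k + 2) i =
      ∑ j, A i j * x k j / (∑ l, A i l * x k l) * (x (k + 1) j / x k j) := by
    intro i
    have h1 := hrowpos k i
    have h2 := hrowpos (k + 1) i
    rw [hy k, hy (k + 1)]
    calc _ = (∑ j, A i j * x (k + 1) j) / ∑ l, A i l * x k l := by field_simp
      _ = _ := by
        rw [Finset.sum_div]
        refine Finset.sum_congr rfl fun j _ => ?_
        have := hx0 k j
        field_simp
  have hymem : ∀ i, y (k + 1) i / y (k + 2) i ∈ Set.Icc m' M' := fun i => by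
    rw [hyr]; exact hmem i
  have hm'0 : 0 < m' := hm0.trans_le hmm
  refine ⟨m', M', hmm, ?_, ?_, hymem, fun j => ?_⟩
  · rw [hlen, Fintype.card_fin, mul_div_cancel₀ _ hn0.ne']
  · have havg : ∑ i : Fin n, (1 / n : ℝ) * (y (k + 1) i / y (k + 2) i) = 1 := by
      calc _ = ∑ i, ∑ j, x (k + 1) j * (A i j * y (k + 1) i) := by
            refine Finset.sum_congr rfl fun i _ => ?_
            have h2 := hrowpos (k + 1) i
            rw [hy (k + 1)]
            calc _ = (∑ j, A i j * x (k + 1) j) * y (k + 1) i := by field_simp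
              _ = _ := by
                rw [Finset.sum_mul]
                exact Finset.sum_congr rfl fun j _ => by ring
        _ = ∑ _j : Fin n, (1 / n : ℝ) := by
            rw [Finset.sum_comm]
            refine Finset.sum_congr rfl fun j _ => ?_
            have h := hcolpos (k + 1) j
            rw [← Finset.mul_sum, hx]
            field_simp
        _ = 1 := by simp [hn0.ne']
    rw [← havg]
    exact weighted_average_mem_Icc _ _ (fun _ => by positivity) (by simp [hn0.ne']) hymem
  · have hxr : x (k + 1) j / x (k + 2) j =
        ∑ i, A i j * y (k + 1) i / (∑ l, A l j * y (k + 1) l) * (y (k + 2) i / y (k + 1) i) := by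
      have h1 := hcolpos (k + 1) j
      have h2 := hcolpos (k + 2) j
      rw [hx (k + 1), hx (k + 2)]
      calc _ = (∑ i, A i j * y (k + 2) i) / ∑ l, A l j * y (k + 1) l := by field_simp
        _ = _ := by
          rw [Finset.sum_div]
          refine Finset.sum_congr rfl fun i _ => ?_
          have := hy0 (k + 1) i
          field_simp
    have hM'0 : 0 < M' := by
      have h := hymem ⟨0, hn⟩
      exact hm'0.trans_le (h.1.trans h.2)
    have hmemx : x (k + 1) j / x (k + 2) j ∈ Set.Icc M'⁻¹ m'⁻¹ := by
      rw [hxr]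
      refine weighted_average_mem_Icc _ _ (fun i => ?_) ?_ fun i => ?_
      · exact div_nonneg (mul_nonneg (hA i j).le (hy0 _ i).le) (hcolpos _ j).le
      · rw [← Finset.sum_div, div_self (hcolpos _ j).ne']
      · have h := hymem i
        have hpos := div_pos (hy0 (k + 1) i) (hy0 (k + 2) i)
        rw [← inv_div]
        exact ⟨inv_anti₀ hpos h.2, inv_anti₀ hm'0 h.1⟩
    have hpos := div_pos (hx0 (k + 1) j) (hx0 (k + 2) j)
    rw [← inv_div]
    exact ⟨le_inv_of_le_inv₀ hpos hmemx.2, inv_le_of_inv_le₀ hM'0 hmemx.1⟩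

/-- The logarithms of the iterates have geometrically small increments. -/
lemma scaling_log_increments (hn : 1 ≤ n) (hA : ∀ i j, 0 < A i j)
    (hx0 : ∀ k j, 0 < x k j) (hy0 : ∀ k i, 0 < y k i)
    (hx : ∀ k j, x k j = 1 / (n * ∑ i, A i j * y k i))
    (hy : ∀ k i, y (k + 1) i = 1 / (n * ∑ j, A i j * x k j)) :
    ∃ C r : ℝ, r ∈ Set.Ioo (0 : ℝ) 1 ∧
      (∀ k j, |Real.log (x (k + 2) j) - Real.log (x (k + 1) j)| ≤ C * r ^ k) ∧
      ∀ k i, |Real.log (y (k + 2) i) - Real.log (y (k + 1) i)| ≤ C * r ^ k := by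
  have : Nonempty (Fin n) := ⟨⟨0, hn⟩⟩
  obtain ⟨⟨i₀, j₀⟩, hmin⟩ := Finite.exists_min fun q : Fin n × Fin n => A q.1 q.2
  obtain ⟨⟨i₁, j₁⟩, hmax⟩ := Finite.exists_max fun q : Fin n × Fin n => A q.1 q.2
  obtain ⟨j₂, hmin'⟩ := Finite.exists_min fun j => x 1 j / x 0 j
  obtain ⟨j₃, hmax'⟩ := Finite.exists_max fun j => x 1 j / x 0 j
  set a := A i₀ j₀
  set b := A i₁ j₁ + 1
  set μ := x 1 j₂ / x 0 j₂
  set W := x 1 j₃ / x 0 j₃ - μ with hW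
  have ha : 0 < a := hA _ _
  have hab : a < b := (hmin (i₁, j₁)).trans_lt (lt_add_one _)
  have hAa : ∀ i j, a ≤ A i j := fun i j => hmin (i, j)
  have hAb : ∀ i j, A i j ≤ b := fun i j => (hmax (i, j)).trans (lt_add_one _).le
  have hμ : 0 < μ := div_pos (hx0 _ _) (hx0 _ _)
  have hW0 : 0 ≤ W := sub_nonneg.2 (hmax' j₂)
  have hab0 : 0 < a / b := div_pos ha (ha.trans hab)
  have hab1 : a / b < 1 := (div_lt_one (ha.trans hab)).2 hab
  set r := 1 - (a / b) ^ 2 with hr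
  have hr0 : 0 < r := by nlinarith
  have hr1 : r < 1 := by nlinarith
  have hspread : ∀ k, ∃ m M, μ ≤ m ∧ M - m = W * r ^ k ∧
      ∀ j, x (k + 1) j / x k j ∈ Set.Icc m M := by
    intro k
    induction k with
    | zero => exact ⟨μ, x 1 j₃ / x 0 j₃, le_rfl, by simp [hW], fun j => ⟨hmin' j, hmax' j⟩⟩
    | succ k ih =>
      obtain ⟨m, M, hm, hlen, hmem⟩ := ih
      obtain ⟨m', M', hmm, hlen', -, -, hmem'⟩ :=
        scaling_ratio_contraction hn ha hAa hAb hx0 hy0 hx hy (hμ.trans_le hm) hmem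
      exact ⟨m', M', hm.trans hmm, by rw [hlen', hlen, ← hr]; ring, hmem'⟩
  have hlog : ∀ k {m' M' t : ℝ}, μ ≤ m' → M' - m' ≤ W * r ^ k → 1 ∈ Set.Icc m' M' →
      t ∈ Set.Icc m' M' → |Real.log t| ≤ W / μ * r ^ k := by
    intro k m' M' t hm hlen h1 ht
    refine (abs_log_le_of_abs_sub_one_le hμ (hm.trans h1.1) (hm.trans ht.1)
      (ε := W * r ^ k) ?_).trans_eq (by ring)
    rw [abs_le]
    constructor <;> linarith [h1.1, h1.2, ht.1, ht.2]
  have hstep : ∀ k, ∃ m' M', μ ≤ m' ∧ M' - m' ≤ W * r ^ k ∧ 1 ∈ Set.Icc m' M' ∧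
      (∀ i, y (k + 1) i / y (k + 2) i ∈ Set.Icc m' M') ∧
      ∀ j, x (k + 2) j / x (k + 1) j ∈ Set.Icc m' M' := by
    intro k
    obtain ⟨m, M, hm, hlen, hmem⟩ := hspread k
    obtain ⟨m', M', hmm, hlen', h⟩ :=
      scaling_ratio_contraction hn ha hAa hAb hx0 hy0 hx hy (hμ.trans_le hm) hmem
    refine ⟨m', M', hm.trans hmm, ?_, h⟩
    rw [hlen', hlen, ← hr]
    exact mul_le_of_le_one_left (by positivity) hr1.le
  refine ⟨W / μ, r, ⟨hr0, hr1⟩, fun k j => ?_, fun k i => ?_⟩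
  · obtain ⟨m', M', hm, hlen, h1, -, hmem⟩ := hstep k
    rw [← Real.log_div (hx0 _ _).ne' (hx0 _ _).ne']
    exact hlog k hm hlen h1 (hmem j)
  · obtain ⟨m', M', hm, hlen, h1, hmem, -⟩ := hstep k
    rw [abs_sub_comm, ← Real.log_div (hy0 _ _).ne' (hy0 _ _).ne']
    exact hlog k hm hlen h1 (hmem i)

end Scaling

/-- **Geometric convergence of the `D₁AD₂` (Sinkhorn) iteration.** Starting from an arbitrary
strictly positive vector `d2 0`, the alternate row/column rescaling iteration
`d1 (k+1) i = 1 / (n * ∑ j, A i j * d2 k j)`, `d2 (k+1) j = 1 / (n * ∑ i, A i j * d1 (k+1) i)`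
converges geometrically to the (positive) doubly stochastic scaling `p i j = e1 i * e2 j * A i j`
of `A` whose row and column sums all equal `1/n`: for some `C > 0` and `r ∈ (0,1)`,
`|d1 k i * d2 k j * A i j - p i j| ≤ C * r ^ k` for every `k`, `i`, `j`. -/
theorem dad_iteration_converges_geometrically (n : ℕ) (hn : 1 ≤ n)
    (A : Fin n → Fin n → ℝ) (hA : ∀ i j, 0 < A i j)
    (d1 d2 : ℕ → Fin n → ℝ)
    (hd20 : ∀ j, 0 < d2 0 j)
    (hd1it : ∀ k i, d1 (k + 1) i = 1 / (n * ∑ j, A i j * d2 k j))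
    (hd2it : ∀ k j, d2 (k + 1) j = 1 / (n * ∑ i, A i j * d1 (k + 1) i)) :
    ∃ e1 e2 : Fin n → ℝ,
      (∀ i, 0 < e1 i) ∧ (∀ j, 0 < e2 j) ∧
      (∀ i, ∑ j, e1 i * e2 j * A i j = 1 / n) ∧
      (∀ j, ∑ i, e1 i * e2 j * A i j = 1 / n) ∧
      ∃ C : ℝ, 0 < C ∧ ∃ r : ℝ, r ∈ Set.Ioo (0 : ℝ) 1 ∧
        ∀ k, ∀ i j, |d1 k i * d2 k j * A i j - e1 i * e2 j * A i j| ≤ C * r ^ k := by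
  have hn0 : (0 : ℝ) < n := by exact_mod_cast hn
  have : Nonempty (Fin n) := ⟨⟨0, hn⟩⟩
  have hd1pos : ∀ k, (∀ j, 0 < d2 k j) → ∀ i, 0 < d1 (k + 1) i := fun k h i => by
    rw [hd1it]
    have := Finset.sum_pos (fun j _ => mul_pos (hA i j) (h j)) Finset.univ_nonempty
    positivity
  have hd2 : ∀ k j, 0 < d2 k j := by
    intro k
    induction k with
    | zero => exact hd20
    | succ k ih =>
      intro j
      rw [hd2it]
      have := Finset.sum_pos (fun i _ => mul_pos (hA i j) (hd1pos k ih i)) Finset.univ_nonempty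
      positivity
  have hd1 : ∀ k i, 0 < d1 (k + 1) i := fun k => hd1pos k (hd2 k)
  have hrow : ∀ k i, ∑ j, d1 (k + 1) i * d2 k j * A i j = 1 / n := by
    intro k i
    have h := Finset.sum_pos (fun j _ => mul_pos (hA i j) (hd2 k j)) Finset.univ_nonempty
    calc _ = d1 (k + 1) i * ∑ j, A i j * d2 k j := by
          rw [Finset.mul_sum]; exact Finset.sum_congr rfl fun j _ => by ring
      _ = 1 / n := by rw [hd1it]; field_simp
  have hcol : ∀ k j, ∑ i, d1 (k + 1) i * d2 (k + 1) j * A i j = 1 / n := by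
    intro k j
    have h := Finset.sum_pos (fun i _ => mul_pos (hA i j) (hd1 k i)) Finset.univ_nonempty
    calc _ = d2 (k + 1) j * ∑ i, A i j * d1 (k + 1) i := by
          rw [Finset.mul_sum]; exact Finset.sum_congr rfl fun i _ => by ring
      _ = 1 / n := by rw [hd2it]; field_simp
  obtain ⟨C, r, hr, hx, hy⟩ := scaling_log_increments (x := fun k => d2 (k + 1))
    (y := fun k => d1 (k + 1)) hn hA (fun k => hd2 (k + 1)) hd1 hd2it (fun k => hd1it (k + 1))
  choose L2 hL2 hL2' using fun j =>
    exists_limit_of_geometric_increments (z := fun k => Real.log (d2 (k + 2) j)) hr.2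
      fun k => hx k j
  choose L1 hL1 hL1' using fun i =>
    exists_limit_of_geometric_increments (z := fun k => Real.log (d1 (k + 2) i)) hr.2
      fun k => hy k i
  have ht1 : ∀ i, Tendsto (fun k => d1 (k + 2) i) atTop (𝓝 (Real.exp (L1 i))) := fun i =>
    ((Real.continuous_exp.tendsto _).comp (hL1 i)).congr fun k => Real.exp_log (hd1 (k + 1) i)
  have ht2 : ∀ j, Tendsto (fun k => d2 (k + 2) j) atTop (𝓝 (Real.exp (L2 j))) := fun j =>
    ((Real.continuous_exp.tendsto _).comp (hL2 j)).congr fun k => Real.exp_log (hd2 (k + 2) j)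
  refine ⟨fun i => Real.exp (L1 i), fun j => Real.exp (L2 j), fun i => Real.exp_pos _,
    fun j => Real.exp_pos _, fun i => ?_, fun j => ?_, ?_⟩
  · have h : Tendsto (fun k => ∑ j, d1 (k + 3) i * d2 (k + 2) j * A i j) atTop
        (𝓝 (∑ j, Real.exp (L1 i) * Real.exp (L2 j) * A i j)) :=
      tendsto_finsetSum _ fun j _ =>
        (((tendsto_add_atTop_iff_nat 1).2 (ht1 i)).mul (ht2 j)).mul_const _
    refine tendsto_nhds_unique h ?_
    simp only [fun k => hrow (k + 2) i, tendsto_const_nhds]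
  · have h : Tendsto (fun k => ∑ i, d1 (k + 2) i * d2 (k + 2) j * A i j) atTop
        (𝓝 (∑ i, Real.exp (L1 i) * Real.exp (L2 j) * A i j)) :=
      tendsto_finsetSum _ fun i _ => ((ht1 i).mul (ht2 j)).mul_const _
    refine tendsto_nhds_unique h ?_
    simp only [fun k => hcol (k + 1) j, tendsto_const_nhds]
  · set K := 2 * (C / (1 - r))
    have hsum : ∀ k i j, |Real.log (d1 (k + 2) i) + Real.log (d2 (k + 2) j) - (L1 i + L2 j)|
        ≤ K * r ^ k := fun k i j => by
      rw [add_sub_add_comm]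
      exact (abs_add_le _ _).trans (by linarith [hL1' i k, hL2' j k])
    have hK0 : 0 ≤ K := by
      simpa using (abs_nonneg _).trans (hsum 0 ⟨0, hn⟩ ⟨0, hn⟩)
    obtain ⟨B, hB⟩ := Finite.exists_le fun q : Fin n × Fin n =>
      Real.exp (L1 q.1 + L2 q.2) * A q.1 q.2
    have htail : ∀ k (q : Fin n × Fin n), |d1 (k + 2) q.1 * d2 (k + 2) q.2 * A q.1 q.2
        - Real.exp (L1 q.1) * Real.exp (L2 q.2) * A q.1 q.2| ≤ B * (K * Real.exp K) * r ^ k := by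
      rintro k ⟨i, j⟩
      have hrk : r ^ k ≤ 1 := pow_le_one₀ hr.1.le hr.2.le
      have hd : d1 (k + 2) i * d2 (k + 2) j
          = Real.exp (Real.log (d1 (k + 2) i) + Real.log (d2 (k + 2) j)) := by
        rw [Real.exp_add, Real.exp_log (hd1 (k + 1) i), Real.exp_log (hd2 (k + 2) j)]
      have hs := hsum k i j
      have hB' : Real.exp (L1 i + L2 j) * A i j ≤ B := hB (i, j)
      dsimp only
      rw [← sub_mul, abs_mul, abs_of_pos (hA i j), hd, ← Real.exp_add]
      calc _ ≤ _ := mul_le_mul_of_nonneg_right (abs_exp_sub_exp_le _ _) (hA i j).le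
        _ ≤ Real.exp (L1 i + L2 j) * (K * r ^ k * Real.exp K) * A i j := by
            have := (hA i j).le
            have := pow_pos hr.1 k
            gcongr
            exact hs.trans (mul_le_of_le_one_right hK0 hrk)
        _ = Real.exp (L1 i + L2 j) * A i j * (K * Real.exp K * r ^ k) := by ring
        _ ≤ B * (K * Real.exp K * r ^ k) := by
            have := pow_pos hr.1 k
            gcongr
        _ = _ := by ring
    obtain ⟨C', hC', hbound⟩ := exists_geometric_bound_of_shift hr.1
      (fun k (q : Fin n × Fin n) => d1 k q.1 * d2 k q.2 * A q.1 q.2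
        - Real.exp (L1 q.1) * Real.exp (L2 q.2) * A q.1 q.2) htail
    exact ⟨C', hC', r, hr, fun k i j => hbound k (i, j)⟩
end

section
/- Let A : [0,1]² → ℝ be a continuous function with A(u,v) > 0 for all (u,v) ∈ [0,1]². Then there exist continuous strictly positive functions d₁, d₂ : [0,1] → ℝ such that the function (u,v) ↦ d₁(u)·d₂(v)·A(u,v) is a copula density; this copula density is called the C-projection of A. -/
open MeasureTheory

/-- A copula density on `[0,1]²`: a continuous nonnegative function whose horizontal and
vertical sections all integrate to `1`. -/
def IsCopulaDensity (c : ℝ → ℝ → ℝ) : Prop :=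
  ContinuousOn (fun p : ℝ × ℝ => c p.1 p.2) ((Set.Icc (0:ℝ) 1) ×ˢ (Set.Icc (0:ℝ) 1)) ∧
  (∀ u ∈ Set.Icc (0:ℝ) 1, ∀ v ∈ Set.Icc (0:ℝ) 1, 0 ≤ c u v) ∧
  (∀ u ∈ Set.Icc (0:ℝ) 1, ∫ v in (0:ℝ)..1, c u v = 1) ∧
  (∀ v ∈ Set.Icc (0:ℝ) 1, ∫ u in (0:ℝ)..1, c u v = 1)

section Topology

variable {X : Type*} [TopologicalSpace X] [CompactSpace X]

/-- The quotient `exp ψ / exp φ` takes values in an interval `[a, r * a]` with `0 < a`. -/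
def HasRatioBound (φ ψ : C(X, ℝ)) (r : ℝ) : Prop :=
  ∃ a > 0, ∀ x, a * Real.exp (φ x) ≤ Real.exp (ψ x) ∧
    Real.exp (ψ x) ≤ r * a * Real.exp (φ x)

lemma exists_hasRatioBound (φ ψ : C(X, ℝ)) : ∃ r ≥ 1, HasRatioBound φ ψ r := by
  have hd : ∀ x, |φ x - ψ x| ≤ dist φ ψ := fun x => by
    rw [← Real.dist_eq]
    exact ContinuousMap.dist_apply_le_dist x
  refine ⟨Real.exp (dist φ ψ + dist φ ψ), Real.one_le_exp (by positivity),
    Real.exp (-dist φ ψ), Real.exp_pos _, fun x => ?_⟩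
  simp only [← Real.exp_add, Real.exp_le_exp]
  have := abs_le.1 (hd x)
  constructor <;> linarith

lemma exists_bounds_of_pos [Nonempty X] (A : C(X, ℝ)) (hA : ∀ p, 0 < A p) :
    ∃ m M : ℝ, 0 < m ∧ m ≤ M ∧ (∀ p, m ≤ A p) ∧ ∀ p, A p ≤ M := by
  obtain ⟨p, -, hp⟩ := isCompact_univ.exists_isMinOn Set.univ_nonempty A.continuous.continuousOn
  obtain ⟨q, -, hq⟩ := isCompact_univ.exists_isMaxOn Set.univ_nonempty A.continuous.continuousOn
  exact ⟨A p, A q, hA p, hp (Set.mem_univ q), fun x => hp (Set.mem_univ x),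
    fun x => hq (Set.mem_univ x)⟩

end Topology

section Scaling

variable {X Y : Type*} [TopologicalSpace X] [CompactSpace X] [T2Space X]
  [SecondCountableTopology X] [MeasurableSpace X] [BorelSpace X]
  [TopologicalSpace Y]

/-- A continuous function on a compact space is integrable for a finite measure. -/
lemma Continuous.integrable_of_compactSpace {f : X → ℝ} (hf : Continuous f)
    (μ : Measure X) [IsFiniteMeasure μ] : Integrable f μ :=
  hf.integrable_of_hasCompactSupport (HasCompactSupport.of_compactSpace f)

lemma integral_pos_of_continuous {f : X → ℝ} (hf : Continuous f) (hpos : ∀ x, 0 < f x)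
    (μ : Measure X) [IsProbabilityMeasure μ] : 0 < ∫ x, f x ∂μ := by
  rw [integral_pos_iff_support_of_nonneg (fun x => (hpos x).le)
    (hf.integrable_of_compactSpace μ)]
  have : Function.support f = Set.univ := by
    ext x
    simp [(hpos x).ne']
  simp [this]

lemma integral_mul_exp_pos (μ : Measure X) [IsProbabilityMeasure μ] {A : C(X × Y, ℝ)}
    (hA : ∀ p, 0 < A p) (φ : C(X, ℝ)) (y : Y) :
    0 < ∫ x, A (x, y) * Real.exp (φ x) ∂μ :=
  integral_pos_of_continuous (by fun_prop) (fun x => mul_pos (hA _) (Real.exp_pos _)) μ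

variable [CompactSpace Y] [T2Space Y] [SecondCountableTopology Y]

lemma continuous_integral_mul_exp (μ : Measure X) [IsProbabilityMeasure μ] (A : C(X × Y, ℝ))
    (φ : C(X, ℝ)) : Continuous fun y => ∫ x, A (x, y) * Real.exp (φ x) ∂μ := by
  have h := continuous_parametric_integral_of_continuous (μ := μ) (s := Set.univ)
    (f := fun y x => A (x, y) * Real.exp (φ x))
    (by unfold Function.uncurry; fun_prop) isCompact_univ
  simpa using h

/-- The logarithmic potential `y ↦ -log ∫ A(x, y) exp (φ x) dμ(x)`, the half-step of the
Sinkhorn iteration. -/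
noncomputable def sinkhornStep (μ : Measure X) [IsProbabilityMeasure μ] {A : C(X × Y, ℝ)}
    (hA : ∀ p, 0 < A p) (φ : C(X, ℝ)) : C(Y, ℝ) where
  toFun y := -Real.log (∫ x, A (x, y) * Real.exp (φ x) ∂μ)
  continuous_toFun := ((continuous_integral_mul_exp μ A φ).log
    fun y => (integral_mul_exp_pos μ hA φ y).ne').neg

lemma exp_sinkhornStep (μ : Measure X) [IsProbabilityMeasure μ] {A : C(X × Y, ℝ)}
    (hA : ∀ p, 0 < A p) (φ : C(X, ℝ)) (y : Y) :
    Real.exp (sinkhornStep μ hA φ y) = (∫ x, A (x, y) * Real.exp (φ x) ∂μ)⁻¹ := by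
  change Real.exp (-Real.log _) = _
  rw [Real.exp_neg, Real.exp_log (integral_mul_exp_pos μ hA φ y)]

lemma integral_mul_exp_sinkhornStep (μ : Measure X) [IsProbabilityMeasure μ] {A : C(X × Y, ℝ)}
    (hA : ∀ p, 0 < A p) (φ : C(X, ℝ)) (y : Y) :
    ∫ x, A (x, y) * Real.exp (φ x) * Real.exp (sinkhornStep μ hA φ y) ∂μ = 1 := by
  rw [integral_mul_const, exp_sinkhornStep,
    mul_inv_cancel₀ (integral_mul_exp_pos μ hA φ y).ne']

lemma sinkhornStep_le_add (μ : Measure X) [IsProbabilityMeasure μ] {A : C(X × Y, ℝ)}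
    (hA : ∀ p, 0 < A p) {φ ψ : C(X, ℝ)} {c : ℝ} (h : ∀ x, φ x ≤ ψ x + c) (y : Y) :
    sinkhornStep μ hA ψ y ≤ sinkhornStep μ hA φ y + c := by
  have hint : ∫ x, A (x, y) * Real.exp (φ x) ∂μ
      ≤ (∫ x, A (x, y) * Real.exp (ψ x) ∂μ) * Real.exp c := by
    rw [← integral_mul_const]
    refine integral_mono (Continuous.integrable_of_compactSpace (by fun_prop) μ)
      (Continuous.integrable_of_compactSpace (by fun_prop) μ) fun x => ?_
    change A (x, y) * Real.exp (φ x) ≤ A (x, y) * Real.exp (ψ x) * Real.exp c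
    rw [mul_assoc, ← Real.exp_add]
    exact mul_le_mul_of_nonneg_left (Real.exp_le_exp.2 (h x)) (hA _).le
  have hlog := Real.log_le_log (integral_mul_exp_pos μ hA φ y) hint
  rw [Real.log_mul (integral_mul_exp_pos μ hA ψ y).ne' (Real.exp_pos c).ne',
    Real.log_exp] at hlog
  change -Real.log _ ≤ -Real.log _ + c
  linarith

lemma lipschitzWith_sinkhornStep (μ : Measure X) [IsProbabilityMeasure μ] {A : C(X × Y, ℝ)}
    (hA : ∀ p, 0 < A p) : LipschitzWith 1 (sinkhornStep μ hA) := by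
  refine LipschitzWith.of_dist_le_mul fun φ ψ => ?_
  rw [NNReal.coe_one, one_mul, ContinuousMap.dist_le dist_nonneg]
  intro y
  have hd : ∀ x, |φ x - ψ x| ≤ dist φ ψ := fun x => by
    rw [← Real.dist_eq]
    exact ContinuousMap.dist_apply_le_dist x
  rw [Real.dist_eq, abs_le]
  constructor
  · have := sinkhornStep_le_add μ hA (φ := φ) (ψ := ψ) (c := dist φ ψ)
      (fun x => by linarith [(abs_le.1 (hd x)).2]) y
    linarith
  · have := sinkhornStep_le_add μ hA (φ := ψ) (ψ := φ) (c := dist φ ψ)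
      (fun x => by linarith [(abs_le.1 (hd x)).1]) y
    linarith

/-- The Birkhoff–Hopf contraction estimate for a Sinkhorn half-step. -/
lemma HasRatioBound.sinkhornStep {μ : Measure X} [IsProbabilityMeasure μ] {A : C(X × Y, ℝ)}
    (hA : ∀ p, 0 < A p) {m M : ℝ} (hm : 0 < m) (hmA : ∀ p, m ≤ A p) (hAM : ∀ p, A p ≤ M)
    (hmM : m ≤ M) {φ ψ : C(X, ℝ)} {r : ℝ} (hr : 1 ≤ r) (h : HasRatioBound φ ψ r) :
    HasRatioBound (sinkhornStep μ hA φ) (sinkhornStep μ hA ψ)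
      (1 + (1 - m / M) * (r - 1)) := by
  obtain ⟨a, ha, hx⟩ := h
  have hM : 0 < M := hm.trans_le hmM
  set ε := m / M with hε
  have hε0 : 0 < ε := div_pos hm hM
  have hε1 : ε ≤ 1 := (div_le_one hM).2 hmM
  have hεM : ε * M = m := div_mul_cancel₀ m hM.ne'
  set G := ∫ x, Real.exp (φ x) ∂μ with hG
  set F := ∫ x, Real.exp (ψ x) ∂μ with hF
  have iG : Integrable (fun x => Real.exp (φ x)) μ :=
    Continuous.integrable_of_compactSpace (by fun_prop) μ
  have iF : Integrable (fun x => Real.exp (ψ x)) μ :=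
    Continuous.integrable_of_compactSpace (by fun_prop) μ
  have hG0 : 0 < G := integral_pos_of_continuous (by fun_prop) (fun x => Real.exp_pos _) μ
  set t := F / G with ht
  have htG : F = t * G := (div_mul_cancel₀ F hG0.ne').symm
  have hat : a ≤ t := by
    rw [ht, le_div_iff₀ hG0, hG, hF, ← integral_const_mul]
    exact integral_mono (iG.const_mul a) iF fun x => (hx x).1
  have htb : t ≤ r * a := by
    rw [ht, div_le_iff₀ hG0, hG, hF, ← integral_const_mul]
    exact integral_mono iF (iG.const_mul _) fun x => (hx x).2
  have ha' : 0 < (1 - ε) * a + ε * t := by nlinarith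
  have key : ∀ y, ((1 - ε) * a + ε * t) * ∫ x, A (x, y) * Real.exp (φ x) ∂μ
        ≤ ∫ x, A (x, y) * Real.exp (ψ x) ∂μ ∧
      ∫ x, A (x, y) * Real.exp (ψ x) ∂μ
        ≤ ((1 - ε) * (r * a) + ε * t) * ∫ x, A (x, y) * Real.exp (φ x) ∂μ := by
    intro y
    have iKG : Integrable (fun x => A (x, y) * Real.exp (φ x)) μ :=
      Continuous.integrable_of_compactSpace (by fun_prop) μ
    have iKF : Integrable (fun x => A (x, y) * Real.exp (ψ x)) μ :=
      Continuous.integrable_of_compactSpace (by fun_prop) μ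
    have hKG : ∫ x, A (x, y) * Real.exp (φ x) ∂μ ≤ M * G := by
      rw [hG, ← integral_const_mul]
      exact integral_mono iKG (iG.const_mul M) fun x =>
        mul_le_mul_of_nonneg_right (hAM _) (Real.exp_pos _).le
    have hεKG : ε * ∫ x, A (x, y) * Real.exp (φ x) ∂μ ≤ m * G := by
      rw [← hεM, mul_assoc]
      exact mul_le_mul_of_nonneg_left hKG hε0.le
    have lower : m * (F - a * G) ≤ ∫ x, A (x, y) * Real.exp (ψ x) ∂μ
        - a * ∫ x, A (x, y) * Real.exp (φ x) ∂μ := by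
      rw [hG, hF, ← integral_const_mul, ← integral_const_mul,
        ← integral_sub iF (iG.const_mul a), ← integral_sub iKF (iKG.const_mul a),
        ← integral_const_mul]
      refine integral_mono ((iF.sub (iG.const_mul a)).const_mul m)
        (iKF.sub (iKG.const_mul a)) fun x => ?_
      change m * (Real.exp (ψ x) - a * Real.exp (φ x))
        ≤ A (x, y) * Real.exp (ψ x) - a * (A (x, y) * Real.exp (φ x))
      nlinarith [mul_le_mul_of_nonneg_right (hmA (x, y)) (sub_nonneg.2 (hx x).1)]
    have upper : m * (r * a * G - F) ≤ r * a * ∫ x, A (x, y) * Real.exp (φ x) ∂μ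
        - ∫ x, A (x, y) * Real.exp (ψ x) ∂μ := by
      rw [hG, hF, ← integral_const_mul, ← integral_const_mul,
        ← integral_sub (iG.const_mul _) iF, ← integral_sub (iKG.const_mul _) iKF,
        ← integral_const_mul]
      refine integral_mono (((iG.const_mul _).sub iF).const_mul m)
        ((iKG.const_mul _).sub iKF) fun x => ?_
      change m * (r * a * Real.exp (φ x) - Real.exp (ψ x))
        ≤ r * a * (A (x, y) * Real.exp (φ x)) - A (x, y) * Real.exp (ψ x)
      nlinarith [mul_le_mul_of_nonneg_right (hmA (x, y)) (sub_nonneg.2 (hx x).2)]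
    rw [htG] at lower upper
    have l := mul_le_mul_of_nonneg_left hεKG (sub_nonneg.2 hat)
    have u := mul_le_mul_of_nonneg_left hεKG (sub_nonneg.2 htb)
    constructor <;> linarith
  set a' := (1 - ε) * a + ε * t with ha'def
  set r' := 1 + (1 - ε) * (r - 1) with hr'def
  have hr' : 1 ≤ r' := by nlinarith
  have hb' : (1 - ε) * (r * a) + ε * t ≤ r' * a' := by
    have : a ≤ a' := by nlinarith
    have := mul_le_mul_of_nonneg_left this
      (mul_nonneg (sub_nonneg.2 hε1) (sub_nonneg.2 hr))
    rw [hr'def]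
    linarith
  have hr'0 : 0 < r' := by linarith
  refine ⟨(r' * a')⁻¹, by positivity, fun y => ?_⟩
  have hφ := integral_mul_exp_pos μ hA φ y
  have hψ := integral_mul_exp_pos μ hA ψ y
  rw [exp_sinkhornStep, exp_sinkhornStep]
  constructor
  · rw [← mul_inv]
    exact inv_anti₀ hψ ((key y).2.trans (mul_le_mul_of_nonneg_right hb' hφ.le))
  · have : r' * (r' * a')⁻¹ = a'⁻¹ := by field_simp
    rw [this, ← mul_inv]
    exact inv_anti₀ (mul_pos ha' hφ) (key y).1

lemma HasRatioBound.dist_le {μ : Measure X} [IsProbabilityMeasure μ] {φ ψ : C(X, ℝ)} {r : ℝ}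
    (hr : 1 ≤ r) (h : HasRatioBound φ ψ r)
    (hmass : ∫ x, Real.exp (φ x - ψ x) ∂μ = 1) : dist φ ψ ≤ r - 1 := by
  obtain ⟨a, ha, hx⟩ := h
  have hr0 : 0 < r := by linarith
  have hi : Integrable (fun x => Real.exp (φ x - ψ x)) μ :=
    Continuous.integrable_of_compactSpace (by fun_prop) μ
  have h1 : a ≤ 1 := by
    have : ∫ x, a * Real.exp (φ x - ψ x) ∂μ ≤ ∫ _, (1 : ℝ) ∂μ :=
      integral_mono (hi.const_mul a) (integrable_const _) fun x => by
        change a * Real.exp (φ x - ψ x) ≤ 1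
        rw [Real.exp_sub, ← mul_div_assoc, div_le_one (Real.exp_pos _)]
        exact (hx x).1
    simpa [integral_const_mul, hmass] using this
  have h2 : 1 ≤ r * a := by
    have : ∫ _, (1 : ℝ) ∂μ ≤ ∫ x, r * a * Real.exp (φ x - ψ x) ∂μ :=
      integral_mono (integrable_const _) (hi.const_mul _) fun x => by
        change 1 ≤ r * a * Real.exp (φ x - ψ x)
        rw [Real.exp_sub, ← mul_div_assoc, one_le_div (Real.exp_pos _)]
        exact (hx x).2
    simpa [integral_const_mul, hmass] using this
  have hlog : Real.log r ≤ r - 1 := Real.log_le_sub_one_of_pos hr0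
  rw [ContinuousMap.dist_le (by linarith)]
  intro x
  have e1 : Real.exp (φ x) ≤ Real.exp (Real.log r + ψ x) := by
    rw [Real.exp_add, Real.exp_log hr0]
    have := mul_le_mul_of_nonneg_left (hx x).1 hr0.le
    nlinarith [mul_le_mul_of_nonneg_right h2 (Real.exp_pos (φ x)).le]
  have e2 : Real.exp (ψ x) ≤ Real.exp (Real.log r + φ x) := by
    rw [Real.exp_add, Real.exp_log hr0]
    have : r * a ≤ r * 1 := mul_le_mul_of_nonneg_left h1 hr0.le
    nlinarith [mul_le_mul_of_nonneg_right this (Real.exp_pos (φ x)).le, (hx x).2]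
  rw [Real.exp_le_exp] at e1 e2
  rw [Real.dist_eq, abs_le]
  constructor <;> linarith

variable [MeasurableSpace Y] [BorelSpace Y]

/-- One full Sinkhorn step preserves total mass. -/
lemma integral_exp_sub_sinkhornStep (μ : Measure X) [IsProbabilityMeasure μ]
    (ν : Measure Y) [IsProbabilityMeasure ν] {A : C(X × Y, ℝ)} {B : C(Y × X, ℝ)}
    (hA : ∀ p, 0 < A p) (hB : ∀ p, 0 < B p) (hBA : ∀ x y, B (y, x) = A (x, y)) (φ : C(X, ℝ)) :
    ∫ x, Real.exp (φ x - sinkhornStep ν hB (sinkhornStep μ hA φ) x) ∂μ = 1 := by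
  set ψ := sinkhornStep μ hA φ with hψ
  have h1 : ∀ x, Real.exp (φ x - sinkhornStep ν hB ψ x)
      = ∫ y, A (x, y) * Real.exp (φ x) * Real.exp (ψ y) ∂ν := by
    intro x
    rw [Real.exp_sub, exp_sinkhornStep, div_inv_eq_mul, ← integral_const_mul]
    refine integral_congr_ae (Filter.Eventually.of_forall fun y => ?_)
    simp only [hBA]
    ring
  simp_rw [h1]
  rw [integral_integral_swap]
  · simp [hψ, integral_mul_exp_sinkhornStep]
  · exact Continuous.integrable_of_compactSpace (by unfold Function.uncurry; fun_prop) _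

/-- Every positive continuous kernel on a product of compact probability spaces can be scaled
to have both marginals equal to `1`. -/
theorem exists_scaling_marginals_eq_one [Nonempty X] [Nonempty Y]
    (μ : Measure X) [IsProbabilityMeasure μ] (ν : Measure Y) [IsProbabilityMeasure ν]
    (A : C(X × Y, ℝ)) (hA : ∀ p, 0 < A p) :
    ∃ (φ : C(X, ℝ)) (ψ : C(Y, ℝ)),
      (∀ x, ∫ y, Real.exp (φ x) * Real.exp (ψ y) * A (x, y) ∂ν = 1) ∧
      ∀ y, ∫ x, Real.exp (φ x) * Real.exp (ψ y) * A (x, y) ∂μ = 1 := by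
  obtain ⟨m, M, hm, hmM, hmA, hAM⟩ := exists_bounds_of_pos A hA
  let B : C(Y × X, ℝ) := A.comp ⟨Prod.swap, continuous_swap⟩
  have hB : ∀ p, 0 < B p := fun p => hA _
  let T : C(X, ℝ) → C(X, ℝ) := fun φ => sinkhornStep ν hB (sinkhornStep μ hA φ)
  have hT : Continuous T :=
    (lipschitzWith_sinkhornStep ν hB).continuous.comp
      (lipschitzWith_sinkhornStep μ hA).continuous
  have hM : 0 < M := hm.trans_le hmM
  set q := 1 - m / M with hq
  have hq0 : 0 ≤ q := sub_nonneg.2 ((div_le_one hM).2 hmM)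
  have hq1 : q < 1 := sub_lt_self 1 (div_pos hm hM)
  obtain ⟨r, hr, hbound⟩ := exists_hasRatioBound (0 : C(X, ℝ)) (T 0)
  have hiter : ∀ n : ℕ, HasRatioBound (T^[n] 0) (T^[n + 1] 0)
      (1 + (q * q) ^ n * (r - 1)) := by
    intro n
    induction n with
    | zero => simpa using hbound
    | succ n ih =>
      have hpos : 0 ≤ (q * q) ^ n * (r - 1) :=
        mul_nonneg (by positivity) (sub_nonneg.2 hr)
      have h1 := ih.sinkhornStep (μ := μ) hA hm hmA hAM hmM (by linarith)
      rw [← hq, add_sub_cancel_left] at h1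
      have h2 := h1.sinkhornStep (μ := ν) hB hm (fun p => hmA _) (fun p => hAM _) hmM
        (by nlinarith)
      rw [← hq, add_sub_cancel_left] at h2
      rw [Function.iterate_succ_apply' T n, Function.iterate_succ_apply' T (n + 1)]
      convert h2 using 2
      ring
  have hdist : ∀ n : ℕ, dist (T^[n] 0) (T^[n + 1] 0) ≤ (r - 1) * (q * q) ^ n := by
    intro n
    have hpos : 0 ≤ (q * q) ^ n * (r - 1) :=
      mul_nonneg (by positivity) (sub_nonneg.2 hr)
    have hmass : ∫ x, Real.exp ((T^[n] 0) x - (T^[n + 1] 0) x) ∂μ = 1 := by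
      rw [Function.iterate_succ_apply' T n]
      exact integral_exp_sub_sinkhornStep μ ν hA hB (fun _ _ => rfl) _
    have := (hiter n).dist_le (by linarith) hmass
    linarith
  obtain ⟨φ, hφ⟩ := cauchySeq_tendsto_of_complete
    (cauchySeq_of_le_geometric (q * q) (r - 1) (by nlinarith) hdist)
  have hfix : T φ = φ := isFixedPt_of_tendsto_iterate hφ hT.continuousAt
  refine ⟨φ, sinkhornStep μ hA φ, fun x => ?_, fun y => ?_⟩
  · have h := integral_mul_exp_sinkhornStep ν hB (sinkhornStep μ hA φ) x
    change ∫ y, A (x, y) * _ * Real.exp (T φ x) ∂ν = 1 at h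
    rw [hfix] at h
    rw [← h]
    congr 1 with y
    ring
  · rw [← integral_mul_exp_sinkhornStep μ hA φ y]
    congr 1 with x
    ring

end Scaling

lemma intervalIntegral_eq_integral_unitInterval (f : ℝ → ℝ) :
    ∫ x in (0:ℝ)..1, f x = ∫ x : unitInterval, f x := by
  rw [intervalIntegral.integral_of_le zero_le_one, ← integral_Icc_eq_integral_Ioc]
  exact (integral_subtype measurableSet_Icc f).symm

/-- **Existence of the C-projection.** For any continuous strictly positive function `A` on
`[0,1]²` there exist continuous strictly positive functions `d₁, d₂ : [0,1] → ℝ` such that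
`(u,v) ↦ d₁ u * d₂ v * A u v` is a copula density. -/
theorem cProjection_exists (A : ℝ → ℝ → ℝ)
    (hAcont : ContinuousOn (fun p : ℝ × ℝ => A p.1 p.2)
      ((Set.Icc (0:ℝ) 1) ×ˢ (Set.Icc (0:ℝ) 1)))
    (hApos : ∀ u ∈ Set.Icc (0:ℝ) 1, ∀ v ∈ Set.Icc (0:ℝ) 1, 0 < A u v) :
    ∃ d1 d2 : ℝ → ℝ,
      ContinuousOn d1 (Set.Icc (0:ℝ) 1) ∧ ContinuousOn d2 (Set.Icc (0:ℝ) 1) ∧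
      (∀ u ∈ Set.Icc (0:ℝ) 1, 0 < d1 u) ∧ (∀ v ∈ Set.Icc (0:ℝ) 1, 0 < d2 v) ∧
      IsCopulaDensity (fun u v => d1 u * d2 v * A u v) := by
  let K : C(unitInterval × unitInterval, ℝ) :=
    ⟨fun p => A p.1 p.2, hAcont.comp_continuous
      (f := fun p : unitInterval × unitInterval => ((p.1 : ℝ), (p.2 : ℝ)))
      (by fun_prop) fun p => ⟨p.1.2, p.2.2⟩⟩
  obtain ⟨φ, ψ, hφ, hψ⟩ := exists_scaling_marginals_eq_one volume volume K
    fun p => hApos _ p.1.2 _ p.2.2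
  have hproj : Continuous (Set.projIcc (0:ℝ) 1 zero_le_one) := continuous_projIcc
  have h1 : Continuous fun u => Real.exp (φ (Set.projIcc (0:ℝ) 1 zero_le_one u)) :=
    (φ.continuous.comp hproj).rexp
  have h2 : Continuous fun v => Real.exp (ψ (Set.projIcc (0:ℝ) 1 zero_le_one v)) :=
    (ψ.continuous.comp hproj).rexp
  refine ⟨_, _, h1.continuousOn, h2.continuousOn, fun _ _ => Real.exp_pos _,
    fun _ _ => Real.exp_pos _, ?_, fun u hu v hv => ?_, fun u hu => ?_, fun v hv => ?_⟩
  · exact ((h1.comp continuous_fst).mul (h2.comp continuous_snd)).continuousOn.mul hAcont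
  · exact mul_nonneg (mul_pos (Real.exp_pos _) (Real.exp_pos _)).le (hApos u hu v hv).le
  · rw [intervalIntegral_eq_integral_unitInterval]
    simp only [Set.projIcc_val, Set.projIcc_of_mem zero_le_one hu]
    exact hφ ⟨u, hu⟩
  · rw [intervalIntegral_eq_integral_unitInterval]
    simp only [Set.projIcc_val, Set.projIcc_of_mem zero_le_one hv]
    exact hψ ⟨v, hv⟩
end

section
/- Let g be a continuous strictly positive copula density on [0,1]². For every ε > 0 there exists δ > 0 such that: for every continuous strictly positive function f : [0,1]² → ℝ with sup_{(u,v)∈[0,1]²} |g(u,v) − f(u,v)| < δ, and for every pair of continuous strictly positive functions d₁, d₂ : [0,1] → ℝ such that (u,v) ↦ d₁(u)d₂(v)f(u,v) is a copula density, one has sup_{(u,v)∈[0,1]²} |g(u,v) − d₁(u)d₂(v)f(u,v)| < ε. -/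
open MeasureTheory

open Set

/-- Bounds for the integral of `y * f` over `[0,1]` when `0 ≤ y ≤ 1` and `f` is within relative
error `t` of a probability density `g` with values in `[m, M]`. -/
lemma integral_mul_bounds_of_le_one {f g y : ℝ → ℝ} {t m M : ℝ}
    (hf : ContinuousOn f (Icc 0 1)) (hg : ContinuousOn g (Icc 0 1))
    (hy : ContinuousOn y (Icc 0 1)) (ht : 0 ≤ t) (ht1 : t ≤ 1)
    (hm : ∀ v ∈ Icc (0:ℝ) 1, m ≤ g v) (hM : ∀ v ∈ Icc (0:ℝ) 1, g v ≤ M)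
    (hfg : ∀ v ∈ Icc (0:ℝ) 1, |g v - f v| ≤ t * g v)
    (hy0 : ∀ v ∈ Icc (0:ℝ) 1, 0 ≤ y v) (hy1 : ∀ v ∈ Icc (0:ℝ) 1, y v ≤ 1)
    (hint : ∫ v in (0:ℝ)..1, g v = 1) :
    (1 - t) * (1 - M * (1 - ∫ v in (0:ℝ)..1, y v)) ≤ ∫ v in (0:ℝ)..1, y v * f v ∧
      ∫ v in (0:ℝ)..1, y v * f v ≤ (1 + t) * (1 - m * (1 - ∫ v in (0:ℝ)..1, y v)) := by
  have hii {h : ℝ → ℝ} (hh : ContinuousOn h (Icc 0 1)) : IntervalIntegrable h volume 0 1 :=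
    hh.intervalIntegrable_of_Icc zero_le_one
  have key (s c : ℝ) : ∫ v in (0:ℝ)..1, s * (g v - c * (1 - y v)) =
      s * (1 - c * (1 - ∫ v in (0:ℝ)..1, y v)) := by
    rw [intervalIntegral.integral_const_mul, intervalIntegral.integral_sub (hii hg)
      (hii (by fun_prop)), intervalIntegral.integral_const_mul,
      intervalIntegral.integral_sub (hii (by fun_prop)) (hii hy), hint]
    simp
  rw [← key, ← key]
  refine ⟨intervalIntegral.integral_mono_on zero_le_one (hii (by fun_prop)) (hii (by fun_prop))
    fun v hv => ?_, intervalIntegral.integral_mono_on zero_le_one (hii (by fun_prop))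
    (hii (by fun_prop)) fun v hv => ?_⟩
  · have h1 : (1 - t) * g v ≤ f v := by linarith [(abs_le.1 (hfg v hv)).2]
    have h2 := mul_le_mul_of_nonneg_left h1 (hy0 v hv)
    have h3 := mul_le_mul_of_nonneg_left (hM v hv)
      (mul_nonneg (sub_nonneg.2 ht1) (sub_nonneg.2 (hy1 v hv)))
    linarith
  · have h1 : f v ≤ (1 + t) * g v := by linarith [(abs_le.1 (hfg v hv)).1]
    have h2 := mul_le_mul_of_nonneg_left h1 (hy0 v hv)
    have h3 := mul_le_mul_of_nonneg_left (hm v hv)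
      (mul_nonneg (by linarith : 0 ≤ 1 + t) (sub_nonneg.2 (hy1 v hv)))
    linarith

/-- Bounds for the integral of `x * f` over `[0,1]` when `1 ≤ x` and `f` is within relative
error `t` of a probability density `g` with values in `[m, M]`. -/
lemma integral_mul_bounds_of_one_le {f g x : ℝ → ℝ} {t m M : ℝ}
    (hf : ContinuousOn f (Icc 0 1)) (hg : ContinuousOn g (Icc 0 1))
    (hx : ContinuousOn x (Icc 0 1)) (ht : 0 ≤ t) (ht1 : t ≤ 1)
    (hm : ∀ v ∈ Icc (0:ℝ) 1, m ≤ g v) (hM : ∀ v ∈ Icc (0:ℝ) 1, g v ≤ M)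
    (hfg : ∀ v ∈ Icc (0:ℝ) 1, |g v - f v| ≤ t * g v)
    (hx1 : ∀ v ∈ Icc (0:ℝ) 1, 1 ≤ x v)
    (hint : ∫ v in (0:ℝ)..1, g v = 1) :
    (1 - t) * (1 + m * ((∫ v in (0:ℝ)..1, x v) - 1)) ≤ ∫ v in (0:ℝ)..1, x v * f v ∧
      ∫ v in (0:ℝ)..1, x v * f v ≤ (1 + t) * (1 + M * ((∫ v in (0:ℝ)..1, x v) - 1)) := by
  have hii {h : ℝ → ℝ} (hh : ContinuousOn h (Icc 0 1)) : IntervalIntegrable h volume 0 1 :=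
    hh.intervalIntegrable_of_Icc zero_le_one
  have key (s c : ℝ) : ∫ v in (0:ℝ)..1, s * (g v + c * (x v - 1)) =
      s * (1 + c * ((∫ v in (0:ℝ)..1, x v) - 1)) := by
    rw [intervalIntegral.integral_const_mul, intervalIntegral.integral_add (hii hg)
      (hii (by fun_prop)), intervalIntegral.integral_const_mul,
      intervalIntegral.integral_sub (hii hx) (hii (by fun_prop)), hint]
    simp
  rw [← key, ← key]
  refine ⟨intervalIntegral.integral_mono_on zero_le_one (hii (by fun_prop)) (hii (by fun_prop))
    fun v hv => ?_, intervalIntegral.integral_mono_on zero_le_one (hii (by fun_prop))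
    (hii (by fun_prop)) fun v hv => ?_⟩
  · have h1 : (1 - t) * g v ≤ f v := by linarith [(abs_le.1 (hfg v hv)).2]
    have h2 := mul_le_mul_of_nonneg_left h1 (zero_le_one.trans (hx1 v hv))
    have h3 := mul_le_mul_of_nonneg_left (hm v hv)
      (mul_nonneg (sub_nonneg.2 ht1) (sub_nonneg.2 (hx1 v hv)))
    linarith
  · have h1 : f v ≤ (1 + t) * g v := by linarith [(abs_le.1 (hfg v hv)).1]
    have h2 := mul_le_mul_of_nonneg_left h1 (zero_le_one.trans (hx1 v hv))
    have h3 := mul_le_mul_of_nonneg_left (hM v hv)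
      (mul_nonneg (by linarith : 0 ≤ 1 + t) (sub_nonneg.2 (hx1 v hv)))
    linarith

/-- Stability of the scaling factor: `P` is the value of the scaling, `K` the product of the
extremal values of the two marginal scalings, `X` and `Y` the `L¹` deviations of the normalized
marginal scalings from `1`, and `I`, `J` the marginal integrals. -/
lemma abs_sub_one_le_of_scaling_bounds {P K I J X Y t m M s : ℝ}
    (hm : 0 < m) (hmM : m ≤ M) (hs : 0 < s) (hs1 : s ≤ 1 / 30) (hst : t = s * m / (4 * M))
    (hK : 0 < K) (hX : 0 ≤ X) (hY : 0 ≤ Y)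
    (hmin : 1 ≤ K * ((1 + t) * (1 - m * Y))) (hmax : K * ((1 - t) * (1 + m * X)) ≤ 1)
    (hI : (1 - t) * (1 - M * Y) ≤ I) (hI' : I ≤ 1 + t)
    (hJ : 1 - t ≤ J) (hJ' : J ≤ (1 + t) * (1 + M * X))
    (hP : P * (K * I * J) = 1) : |P - 1| ≤ 30 * s := by
  have hM : 0 < M := hm.trans_le hmM
  have ht : 0 < t := by rw [hst]; positivity
  have htM : 4 * M * t = s * m := by rw [hst]; field_simp
  have hts : t ≤ s / 4 := by
    rw [hst, div_le_div_iff₀ (by positivity) (by norm_num)]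
    linarith [mul_le_mul_of_nonneg_left hmM hs.le]
  have hK1 : K * (1 - t) ≤ 1 := by
    have : 0 ≤ K * (1 - t) * (m * X) :=
      mul_nonneg (mul_nonneg hK.le (by linarith)) (by positivity)
    linarith
  have hK2 : 1 ≤ K * (1 + t) := by
    have : 0 ≤ K * (1 + t) * (m * Y) := by positivity
    linarith
  have hmY : m * Y ≤ 2 * t := by
    have h1 : 1 - t ≤ (1 + t) * (1 - m * Y) := by
      by_contra! h
      have := mul_lt_mul_of_pos_left h hK
      linarith
    have : 0 ≤ t * (m * Y) := by positivity
    linarith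
  have hmX : m * X ≤ 4 * t := by
    have h1 : (1 - t) * (1 + m * X) ≤ 1 + t := by
      by_contra! h
      have := mul_lt_mul_of_pos_left h hK
      linarith
    have : 0 ≤ (1 / 2 - t) * (m * X) := mul_nonneg (by linarith) (by positivity)
    linarith
  have hMY : M * Y ≤ s := by
    refine le_of_mul_le_mul_left (?_ : m * (M * Y) ≤ m * s) hm
    have := mul_le_mul_of_nonneg_left hmY hM.le
    have := mul_pos hM ht
    linarith
  have hMX : M * X ≤ s := by
    refine le_of_mul_le_mul_left (?_ : m * (M * X) ≤ m * s) hm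
    have := mul_le_mul_of_nonneg_left hmX hM.le
    linarith
  have hKlo : 1 - s ≤ K := by
    refine (?_ : 1 - s ≤ 1 - t).trans ?_
    · linarith
    · by_contra! h
      have := mul_lt_mul_of_pos_right h (by linarith : 0 < 1 + t)
      linarith [mul_pos ht ht]
  have hKhi : K ≤ 1 + s := by
    by_contra! h
    have := mul_lt_mul_of_pos_right h (by linarith : 0 < 1 - t)
    linarith [mul_le_mul_of_nonneg_right hs1 ht.le]
  have hIlo : (1 - s) * (1 - s) ≤ I :=
    (mul_le_mul (by linarith) (by linarith) (by linarith) (by linarith)).trans hI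
  have hJhi : J ≤ (1 + s) * (1 + s) :=
    hJ'.trans (mul_le_mul (by linarith) (by linarith) (by positivity) (by linarith))
  have hI0 : 0 ≤ I := (mul_nonneg (by linarith) (by linarith)).trans hIlo
  have hlo : (1 - s) * ((1 - s) * (1 - s)) * (1 - s) ≤ K * I * J := by
    have h0 : 0 ≤ 1 - s := by linarith
    exact mul_le_mul (mul_le_mul hKlo hIlo (by positivity) hK.le) (by linarith) h0
      (by positivity)
  have hhi : K * I * J ≤ (1 + s) * (1 + s) * ((1 + s) * (1 + s)) :=
    mul_le_mul (mul_le_mul hKhi (by linarith) hI0 (by linarith)) hJhi (by linarith)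
      (by positivity)
  set Q := K * I * J
  have hQlo : 1 - 15 * s ≤ Q := by
    have := one_add_mul_le_pow (by linarith : -2 ≤ -s) 4
    push_cast at this
    linarith
  have hQhi : Q ≤ 1 + 15 * s := by
    have h2 : s * s ≤ s := mul_le_of_le_one_left hs.le (by linarith)
    have h3 : (1 + s) * (1 + s) ≤ 1 + 3 * s := by linarith
    have h4 := mul_le_mul h3 h3 (by positivity) (by positivity)
    linarith
  have hQ2 : 1 / 2 ≤ Q := by linarith
  have hP0 : 0 < P := by
    by_contra! h
    have := mul_nonpos_of_nonpos_of_nonneg h (by linarith : 0 ≤ Q)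
    linarith
  have hP2 : P ≤ 2 := by linarith [mul_le_mul_of_nonneg_left hQ2 hP0.le]
  have h1 : P - 1 = P * (1 - Q) := by linarith
  have h2 : |1 - Q| ≤ 15 * s := abs_le.2 ⟨by linarith, by linarith⟩
  rw [h1, abs_mul, abs_of_pos hP0]
  calc P * |1 - Q| ≤ 2 * (15 * s) := mul_le_mul hP2 h2 (abs_nonneg _) (by norm_num)
    _ = 30 * s := by ring

/-- **Error control for the C-projection.** Let `g` be a continuous strictly positive copula
density. For every `ε > 0` there is a `δ > 0` such that whenever `f` is a continuous strictly
positive function on `[0,1]²` uniformly within `δ` of `g`, every C-projection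
`(u,v) ↦ d₁ u * d₂ v * f u v` of `f` is uniformly within `ε` of `g`. -/
theorem cProjection_error_control (g : ℝ → ℝ → ℝ) (hg : IsCopulaDensity g)
    (hgpos : ∀ u ∈ Set.Icc (0:ℝ) 1, ∀ v ∈ Set.Icc (0:ℝ) 1, 0 < g u v) :
    ∀ ε > (0:ℝ), ∃ δ > (0:ℝ), ∀ f : ℝ → ℝ → ℝ,
      ContinuousOn (fun p : ℝ × ℝ => f p.1 p.2) ((Set.Icc (0:ℝ) 1) ×ˢ (Set.Icc (0:ℝ) 1)) →
      (∀ u ∈ Set.Icc (0:ℝ) 1, ∀ v ∈ Set.Icc (0:ℝ) 1, 0 < f u v) →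
      (∀ u ∈ Set.Icc (0:ℝ) 1, ∀ v ∈ Set.Icc (0:ℝ) 1, |g u v - f u v| < δ) →
      ∀ d1 d2 : ℝ → ℝ,
        ContinuousOn d1 (Set.Icc (0:ℝ) 1) → ContinuousOn d2 (Set.Icc (0:ℝ) 1) →
        (∀ u ∈ Set.Icc (0:ℝ) 1, 0 < d1 u) → (∀ v ∈ Set.Icc (0:ℝ) 1, 0 < d2 v) →
        IsCopulaDensity (fun u v => d1 u * d2 v * f u v) →
        ∀ u ∈ Set.Icc (0:ℝ) 1, ∀ v ∈ Set.Icc (0:ℝ) 1,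
          |g u v - d1 u * d2 v * f u v| < ε := by
  intro ε hε
  obtain ⟨hgc, -, hg1, hg2⟩ := hg
  have hcomp : IsCompact (Icc (0:ℝ) 1 ×ˢ Icc (0:ℝ) 1) := isCompact_Icc.prod isCompact_Icc
  have hI0 : (0:ℝ) ∈ Icc (0:ℝ) 1 := ⟨le_rfl, zero_le_one⟩
  have hne : (Icc (0:ℝ) 1 ×ˢ Icc (0:ℝ) 1).Nonempty := ⟨(0, 0), hI0, hI0⟩
  obtain ⟨p, hp, hpmin⟩ := hcomp.exists_isMinOn hne hgc
  obtain ⟨q, hq, hqmax⟩ := hcomp.exists_isMaxOn hne hgc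
  set m := g p.1 p.2
  set M := g q.1 q.2
  have hgm : ∀ u ∈ Icc (0:ℝ) 1, ∀ v ∈ Icc (0:ℝ) 1, m ≤ g u v := fun u hu v hv =>
    hpmin (show (u, v) ∈ _ from ⟨hu, hv⟩)
  have hgM : ∀ u ∈ Icc (0:ℝ) 1, ∀ v ∈ Icc (0:ℝ) 1, g u v ≤ M := fun u hu v hv =>
    hqmax (show (u, v) ∈ _ from ⟨hu, hv⟩)
  have hm : 0 < m := hgpos _ hp.1 _ hp.2
  have hmM : m ≤ M := hgM _ hp.1 _ hp.2
  have hM : 0 < M := hm.trans_le hmM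
  obtain ⟨s, hs, hs1, hsε⟩ : ∃ s : ℝ, 0 < s ∧ s ≤ 1 / 30 ∧ 61 * M * s ≤ ε := by
    refine ⟨min (1 / 30) (ε / (61 * M)), by positivity, min_le_left _ _, ?_⟩
    calc 61 * M * min (1 / 30) (ε / (61 * M)) ≤ 61 * M * (ε / (61 * M)) := by
          gcongr; exact min_le_right _ _
      _ = ε := by field_simp
  obtain ⟨t, hst⟩ : ∃ t, t = s * m / (4 * M) := ⟨_, rfl⟩
  have ht : 0 < t := by rw [hst]; positivity
  have hts : t ≤ s / 4 := by
    rw [hst, div_le_div_iff₀ (by positivity) (by norm_num)]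
    linarith [mul_le_mul_of_nonneg_left hmM hs.le]
  refine ⟨t * m, by positivity, ?_⟩
  intro f hfc _ hfg d1 d2 hd1 hd2 hd1pos hd2pos ⟨_, _, hc1, hc2⟩ u hu v hv
  have hrel : ∀ u ∈ Icc (0:ℝ) 1, ∀ v ∈ Icc (0:ℝ) 1, |g u v - f u v| ≤ t * g u v :=
    fun u hu v hv => (hfg u hu v hv).le.trans (mul_le_mul_of_nonneg_left (hgm u hu v hv) ht.le)
  have hrow {h : ℝ → ℝ → ℝ}
      (hh : ContinuousOn (fun p : ℝ × ℝ => h p.1 p.2) (Icc (0:ℝ) 1 ×ˢ Icc (0:ℝ) 1)) :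
      ∀ u ∈ Icc (0:ℝ) 1, ContinuousOn (fun v => h u v) (Icc 0 1) := fun u hu =>
    hh.comp (f := fun v => (u, v)) (by fun_prop) fun v hv => ⟨hu, hv⟩
  have hcol {h : ℝ → ℝ → ℝ}
      (hh : ContinuousOn (fun p : ℝ × ℝ => h p.1 p.2) (Icc (0:ℝ) 1 ×ˢ Icc (0:ℝ) 1)) :
      ∀ v ∈ Icc (0:ℝ) 1, ContinuousOn (fun u => h u v) (Icc 0 1) := fun v hv =>
    hh.comp (f := fun u => (u, v)) (by fun_prop) fun u hu => ⟨hu, hv⟩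
  obtain ⟨u₀, hu₀, humin⟩ := isCompact_Icc.exists_isMinOn ⟨0, hI0⟩ hd1
  obtain ⟨v₀, hv₀, hvmax⟩ := isCompact_Icc.exists_isMaxOn ⟨0, hI0⟩ hd2
  have ha := hd1pos u₀ hu₀
  have hB := hd2pos v₀ hv₀
  set a := d1 u₀
  set B := d2 v₀
  let x : ℝ → ℝ := fun u => d1 u / a
  let y : ℝ → ℝ := fun v => d2 v / B
  have hxc : ContinuousOn x (Icc 0 1) := hd1.div_const a
  have hyc : ContinuousOn y (Icc 0 1) := hd2.div_const B
  have hx1 : ∀ u ∈ Icc (0:ℝ) 1, 1 ≤ x u := fun u hu => (one_le_div ha).2 (humin hu)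
  have hy1 : ∀ v ∈ Icc (0:ℝ) 1, y v ≤ 1 := fun v hv => (div_le_one hB).2 (hvmax hv)
  have hy0 : ∀ v ∈ Icc (0:ℝ) 1, 0 ≤ y v := fun v hv => (div_pos (hd2pos v hv) hB).le
  have hX : 0 ≤ (∫ u in (0:ℝ)..1, x u) - 1 := by
    have := intervalIntegral.integral_mono_on zero_le_one
      (intervalIntegrable_const (c := (1:ℝ)) (μ := volume))
      (hxc.intervalIntegrable_of_Icc zero_le_one) hx1
    simpa using this
  have hY : 0 ≤ 1 - ∫ v in (0:ℝ)..1, y v := by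
    have := intervalIntegral.integral_mono_on zero_le_one
      (hyc.intervalIntegrable_of_Icc zero_le_one)
      (intervalIntegrable_const (c := (1:ℝ)) (μ := volume)) hy1
    simpa using this
  have hyf (u : ℝ) (hu : u ∈ Icc (0:ℝ) 1) := integral_mul_bounds_of_le_one (hrow hfc u hu)
    (hrow hgc u hu) hyc ht.le (by linarith) (hgm u hu) (hgM u hu) (hrel u hu) hy0 hy1 (hg1 u hu)
  have hxf (v : ℝ) (hv : v ∈ Icc (0:ℝ) 1) := integral_mul_bounds_of_one_le (hcol hfc v hv)
    (hcol hgc v hv) hxc ht.le (by linarith) (fun u hu => hgm u hu v hv)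
    (fun u hu => hgM u hu v hv) (fun u hu => hrel u hu v hv) hx1 (hg2 v hv)
  have hrow1 : ∀ u ∈ Icc (0:ℝ) 1, a * B * x u * ∫ v in (0:ℝ)..1, y v * f u v = 1 := by
    intro u hu
    refine Eq.trans ?_ (hc1 u hu)
    rw [← intervalIntegral.integral_const_mul]
    congr 1; ext v; simp only [x, y]; field_simp
  have hcol1 : ∀ v ∈ Icc (0:ℝ) 1, a * B * y v * ∫ u in (0:ℝ)..1, x u * f u v = 1 := by
    intro v hv
    refine Eq.trans ?_ (hc2 v hv)
    rw [← intervalIntegral.integral_const_mul]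
    congr 1; ext u; simp only [x, y]; field_simp
  have hK : 0 < a * B := mul_pos ha hB
  have hP : |d1 u * d2 v - 1| ≤ 30 * s := by
    refine abs_sub_one_le_of_scaling_bounds (K := a * B) (I := ∫ v in (0:ℝ)..1, y v * f u v)
      (J := ∫ u in (0:ℝ)..1, x u * f u v) hm hmM hs hs1 hst hK hX hY ?_ ?_ (hyf u hu).1 ?_ ?_
      (hxf v hv).2 ?_
    · have h := hrow1 u₀ hu₀
      rw [show x u₀ = 1 from div_self ha.ne', mul_one] at h
      refine h.ge.trans ?_
      exact mul_le_mul_of_nonneg_left (hyf u₀ hu₀).2 hK.le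
    · have h := hcol1 v₀ hv₀
      rw [show y v₀ = 1 from div_self hB.ne', mul_one] at h
      refine le_trans ?_ h.le
      exact mul_le_mul_of_nonneg_left (hxf v₀ hv₀).1 hK.le
    · refine (hyf u hu).2.trans (mul_le_of_le_one_right (by linarith) ?_)
      linarith [mul_nonneg hm.le hY]
    · refine (le_mul_of_one_le_right (by linarith) ?_).trans (hxf v hv).1
      linarith [mul_nonneg hm.le hX]
    · have hd : d1 u * d2 v = a * B * x u * y v := by simp only [x, y]; field_simp
      rw [hd]
      linear_combination (a * B * y v * ∫ u in (0:ℝ)..1, x u * f u v) * hrow1 u hu + hcol1 v hv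
  have hfM : |f u v| ≤ 2 * M := by
    have h1 := abs_le.1 (hrel u hu v hv)
    have h2 := hgM u hu v hv
    have h3 : t * g u v ≤ 1 * g u v :=
      mul_le_mul_of_nonneg_right (by linarith) (hgpos u hu v hv).le
    have h4 := hgpos u hu v hv
    exact abs_le.2 ⟨by linarith, by linarith⟩
  calc |g u v - d1 u * d2 v * f u v|
      = |(g u v - f u v) - (d1 u * d2 v - 1) * f u v| := by congr 1; ring
    _ ≤ |g u v - f u v| + |d1 u * d2 v - 1| * |f u v| := by
        rw [← abs_mul]; exact abs_sub _ _
    _ < t * m + 30 * s * (2 * M) :=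
        add_lt_add_of_lt_of_le (hfg u hu v hv)
          (mul_le_mul hP hfM (abs_nonneg _) (by positivity))
    _ ≤ s * M + 30 * s * (2 * M) := by gcongr; linarith
    _ ≤ ε := by linarith
end

section
/- Let c₁₂ and c₂₃ be copula densities on [0,1]², and let c₁₃|₂ : [0,1]² × [0,1] → ℝ be continuous such that for every x₂ ∈ [0,1] the function (u,w) ↦ c₁₃|₂(u,w,x₂) is a copula density. Define the conditional distribution functions F_{1|2}(x₁, x₂) = ∫₀^{x₁} c₁₂(t, x₂) dt and F_{3|2}(x₃, x₂) = ∫₀^{x₃} c₂₃(x₂, t) dt, and set f(x₁,x₂,x₃) = c₁₂(x₁,x₂) · c₂₃(x₂,x₃) · c₁₃|₂(F_{1|2}(x₁,x₂), F_{3|2}(x₃,x₂), x₂). Then f is a probability density on [0,1]³ each of whose three univariate marginals is the uniform density: ∫₀¹∫₀¹ f(x₁,x₂,x₃) dx_j dx_k = 1 for each coordinate and all values of the remaining variable, where {j,k} are the other two indices. In particular, any choice of pair copulae in the three-variable vine yields a well-defined vine-dependent distribution. -/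
open MeasureTheory

section UnitInterval

open Set

/-- The sections at a fixed second argument of a function continuous on the unit square are
continuous on the unit interval. -/
lemma ContinuousOn.section_left {c : ℝ → ℝ → ℝ}
    (hc : ContinuousOn (fun p : ℝ × ℝ => c p.1 p.2) (Icc (0:ℝ) 1 ×ˢ Icc (0:ℝ) 1))
    {v : ℝ} (hv : v ∈ Icc (0:ℝ) 1) : ContinuousOn (fun u => c u v) (Icc (0:ℝ) 1) :=
  hc.comp (f := fun u : ℝ => (u, v)) (by fun_prop) fun _ hu => ⟨hu, hv⟩

/-- The sections at a fixed first argument of a function continuous on the unit square are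
continuous on the unit interval. -/
lemma ContinuousOn.section_right {c : ℝ → ℝ → ℝ}
    (hc : ContinuousOn (fun p : ℝ × ℝ => c p.1 p.2) (Icc (0:ℝ) 1 ×ˢ Icc (0:ℝ) 1))
    {u : ℝ} (hu : u ∈ Icc (0:ℝ) 1) : ContinuousOn (fun v => c u v) (Icc (0:ℝ) 1) :=
  hc.comp (f := fun v : ℝ => (u, v)) (by fun_prop) fun _ hv => ⟨hu, hv⟩

/-- The distribution function of a density on the unit interval takes values there. -/
lemma primitive_mem_unitInterval {g : ℝ → ℝ} (hg : ContinuousOn g (Icc (0:ℝ) 1))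
    (hpos : ∀ t ∈ Icc (0:ℝ) 1, 0 ≤ g t) (hint : ∫ t in (0:ℝ)..1, g t = 1)
    {x : ℝ} (hx : x ∈ Icc (0:ℝ) 1) : (∫ t in (0:ℝ)..x, g t) ∈ Icc (0:ℝ) 1 := by
  refine ⟨intervalIntegral.integral_nonneg hx.1 fun t ht => hpos t ⟨ht.1, ht.2.trans hx.2⟩, ?_⟩
  have hle : (∫ t in (0:ℝ)..x, g t) ≤ ∫ t in (0:ℝ)..1, g t := by
    refine intervalIntegral.integral_mono_interval le_rfl hx.1 hx.2 ?_
      (hg.intervalIntegrable_of_Icc zero_le_one)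
    filter_upwards [ae_restrict_mem measurableSet_Ioc] with t ht
    exact hpos t ⟨ht.1.le, ht.2⟩
  exact hle.trans_eq hint

/-- Probability integral transform: substituting the distribution function of a density on the
unit interval preserves integrals over the unit interval. -/
lemma integral_mul_comp_primitive {g h : ℝ → ℝ} (hg : ContinuousOn g (Icc (0:ℝ) 1))
    (hpos : ∀ t ∈ Icc (0:ℝ) 1, 0 ≤ g t) (hint : ∫ t in (0:ℝ)..1, g t = 1)
    (hh : ContinuousOn h (Icc (0:ℝ) 1)) :
    ∫ x in (0:ℝ)..1, g x * h (∫ t in (0:ℝ)..x, g t) = ∫ u in (0:ℝ)..1, h u := by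
  have huIcc : uIcc (0:ℝ) 1 = Icc 0 1 := uIcc_of_le zero_le_one
  have hsub := intervalIntegral.integral_comp_mul_deriv'' (a := 0) (b := 1)
    (f := fun x => ∫ t in (0:ℝ)..x, g t) (f' := g) (g := h) ?_ ?_ (huIcc ▸ hg) ?_
  · simpa [hint, mul_comm] using hsub
  · exact intervalIntegral.continuousOn_primitive_interval (by
      rw [huIcc]; exact hg.integrableOn_Icc)
  · intro x hx
    rw [min_eq_left zero_le_one, max_eq_right zero_le_one] at hx
    have hnhds : Icc (0:ℝ) 1 ∈ nhds x := Icc_mem_nhds hx.1 hx.2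
    refine (intervalIntegral.integral_hasDerivAt_right ?_ ?_
      (hg.continuousAt hnhds)).hasDerivWithinAt
    · exact (hg.mono (Icc_subset_Icc_right hx.2.le)).intervalIntegrable_of_Icc hx.1.le
    · exact ⟨_, hnhds, hg.aestronglyMeasurable measurableSet_Icc⟩
  · refine hh.mono ?_
    rintro _ ⟨x, hx, rfl⟩
    exact primitive_mem_unitInterval hg hpos hint (huIcc ▸ hx)

/-- A parametric primitive of a function continuous on the unit square is jointly continuous
there. -/
lemma continuousOn_parametric_primitive {c : ℝ → ℝ → ℝ}
    (hc : ContinuousOn (fun p : ℝ × ℝ => c p.1 p.2) (Icc (0:ℝ) 1 ×ˢ Icc (0:ℝ) 1)) :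
    ContinuousOn (fun p : ℝ × ℝ => ∫ t in (0:ℝ)..p.1, c t p.2)
      (Icc (0:ℝ) 1 ×ˢ Icc (0:ℝ) 1) := by
  let π : ℝ → ℝ := fun x => projIcc (0:ℝ) 1 zero_le_one x
  have hπ : Continuous π := continuous_subtype_val.comp continuous_projIcc
  have hπ_mem (x : ℝ) : π x ∈ Icc (0:ℝ) 1 := Subtype.coe_prop _
  have hπ_eq {x : ℝ} (hx : x ∈ Icc (0:ℝ) 1) : π x = x := by
    simp only [π, projIcc_of_mem zero_le_one hx]
  have hext : Continuous (Function.uncurry fun (p : ℝ × ℝ) (t : ℝ) => c (π t) (π p.2)) :=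
    hc.comp_continuous (f := fun q : (ℝ × ℝ) × ℝ => (π q.2, π q.1.2)) (by fun_prop)
      fun q => ⟨hπ_mem _, hπ_mem _⟩
  refine (intervalIntegral.continuous_parametric_intervalIntegral_of_continuous (μ := volume)
    (a₀ := 0) hext continuous_fst).continuousOn.congr ?_
  rintro ⟨x, y⟩ ⟨hx, hy⟩
  refine intervalIntegral.integral_congr fun t ht => ?_
  rw [uIcc_of_le hx.1] at ht
  simp only [hπ_eq hy, hπ_eq ⟨ht.1, ht.2.trans hx.2⟩]

end UnitInterval

/-- **A three-variable D-vine always yields a well-defined vine-dependent distribution.**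
Given copula densities `c₁₂`, `c₂₃` and a continuous family `c₁₃|₂ (·,·,x₂)` of copula
densities, the function
`f x₁ x₂ x₃ = c₁₂ x₁ x₂ * c₂₃ x₂ x₃ * c₁₃|₂ (F₁|₂ x₁ x₂) (F₃|₂ x₃ x₂) x₂`
is a probability density on `[0,1]³` all three of whose univariate marginals are uniform. -/
theorem three_var_vine_density (c12 c23 : ℝ → ℝ → ℝ)
    (h12 : IsCopulaDensity c12) (h23 : IsCopulaDensity c23)
    (c132 : ℝ → ℝ → ℝ → ℝ)
    (h132cont : ContinuousOn (fun p : ℝ × ℝ × ℝ => c132 p.1 p.2.1 p.2.2)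
      ((Set.Icc (0:ℝ) 1) ×ˢ ((Set.Icc (0:ℝ) 1) ×ˢ (Set.Icc (0:ℝ) 1))))
    (h132cop : ∀ x2 ∈ Set.Icc (0:ℝ) 1, IsCopulaDensity (fun u w => c132 u w x2))
    (F12 F32 : ℝ → ℝ → ℝ)
    (hF12 : ∀ x1 x2, F12 x1 x2 = ∫ t in (0:ℝ)..x1, c12 t x2)
    (hF32 : ∀ x3 x2, F32 x3 x2 = ∫ t in (0:ℝ)..x3, c23 x2 t)
    (f : ℝ → ℝ → ℝ → ℝ)
    (hf : ∀ x1 x2 x3,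
      f x1 x2 x3 = c12 x1 x2 * c23 x2 x3 * c132 (F12 x1 x2) (F32 x3 x2) x2) :
    (∀ x1 ∈ Set.Icc (0:ℝ) 1, ∀ x2 ∈ Set.Icc (0:ℝ) 1, ∀ x3 ∈ Set.Icc (0:ℝ) 1,
      0 ≤ f x1 x2 x3) ∧
    (∀ x1 ∈ Set.Icc (0:ℝ) 1,
      (∫ x2 in (0:ℝ)..1, ∫ x3 in (0:ℝ)..1, f x1 x2 x3) = 1) ∧
    (∀ x2 ∈ Set.Icc (0:ℝ) 1,
      (∫ x1 in (0:ℝ)..1, ∫ x3 in (0:ℝ)..1, f x1 x2 x3) = 1) ∧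
    (∀ x3 ∈ Set.Icc (0:ℝ) 1,
      (∫ x1 in (0:ℝ)..1, ∫ x2 in (0:ℝ)..1, f x1 x2 x3) = 1) := by
  obtain ⟨h12cont, h12pos, h12int, h12int'⟩ := h12
  obtain ⟨h23cont, h23pos, h23int, h23int'⟩ := h23
  have hF12mem : ∀ x1 ∈ Set.Icc (0:ℝ) 1, ∀ x2 ∈ Set.Icc (0:ℝ) 1,
      F12 x1 x2 ∈ Set.Icc (0:ℝ) 1 := fun x1 hx1 x2 hx2 => by
    rw [hF12]
    exact primitive_mem_unitInterval (h12cont.section_left hx2)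
      (fun t ht => h12pos t ht x2 hx2) (h12int' x2 hx2) hx1
  have hF32mem : ∀ x3 ∈ Set.Icc (0:ℝ) 1, ∀ x2 ∈ Set.Icc (0:ℝ) 1,
      F32 x3 x2 ∈ Set.Icc (0:ℝ) 1 := fun x3 hx3 x2 hx2 => by
    rw [hF32]
    exact primitive_mem_unitInterval (h23cont.section_right hx2)
      (fun t ht => h23pos x2 hx2 t ht) (h23int x2 hx2) hx3
  have hint3 : ∀ x1 ∈ Set.Icc (0:ℝ) 1, ∀ x2 ∈ Set.Icc (0:ℝ) 1,
      ∫ x3 in (0:ℝ)..1, f x1 x2 x3 = c12 x1 x2 := fun x1 hx1 x2 hx2 => by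
    obtain ⟨hcont, -, hint, -⟩ := h132cop x2 hx2
    have hsub := integral_mul_comp_primitive (h23cont.section_right hx2)
      (fun t ht => h23pos x2 hx2 t ht) (h23int x2 hx2)
      (hcont.section_right (c := fun u w => c132 u w x2) (hF12mem x1 hx1 x2 hx2))
    simp only [hf, hF32, mul_assoc, intervalIntegral.integral_const_mul]
    rw [hsub, hint _ (hF12mem x1 hx1 x2 hx2), mul_one]
  have hint1 : ∀ x3 ∈ Set.Icc (0:ℝ) 1, ∀ x2 ∈ Set.Icc (0:ℝ) 1,
      ∫ x1 in (0:ℝ)..1, f x1 x2 x3 = c23 x2 x3 := fun x3 hx3 x2 hx2 => by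
    obtain ⟨hcont, -, -, hint⟩ := h132cop x2 hx2
    have hsub := integral_mul_comp_primitive (h12cont.section_left hx2)
      (fun t ht => h12pos t ht x2 hx2) (h12int' x2 hx2)
      (hcont.section_left (c := fun u w => c132 u w x2) (hF32mem x3 hx3 x2 hx2))
    simp only [hf, hF12, mul_comm (c12 _ _) (c23 _ _), mul_assoc, intervalIntegral.integral_const_mul]
    rw [hsub, hint _ (hF32mem x3 hx3 x2 hx2), mul_one]
  have huIcc : Set.uIcc (0:ℝ) 1 = Set.Icc 0 1 := Set.uIcc_of_le zero_le_one
  refine ⟨fun x1 hx1 x2 hx2 x3 hx3 => ?_, fun x1 hx1 => ?_, fun x2 hx2 => ?_, fun x3 hx3 => ?_⟩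
  · rw [hf]
    exact mul_nonneg (mul_nonneg (h12pos x1 hx1 x2 hx2) (h23pos x2 hx2 x3 hx3))
      ((h132cop x2 hx2).2.1 _ (hF12mem x1 hx1 x2 hx2) _ (hF32mem x3 hx3 x2 hx2))
  · exact (intervalIntegral.integral_congr fun x2 hx2 =>
      hint3 x1 hx1 x2 (huIcc ▸ hx2)).trans (h12int x1 hx1)
  · exact (intervalIntegral.integral_congr fun x1 hx1 =>
      hint3 x1 (huIcc ▸ hx1) x2 hx2).trans (h12int' x2 hx2)
  · have hF12cont : ContinuousOn (fun p : ℝ × ℝ => F12 p.1 p.2)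
        (Set.Icc (0:ℝ) 1 ×ˢ Set.Icc (0:ℝ) 1) := by
      simpa only [hF12] using continuousOn_parametric_primitive h12cont
    have hF32cont : ContinuousOn (fun p : ℝ × ℝ => F32 x3 p.2)
        (Set.Icc (0:ℝ) 1 ×ˢ Set.Icc (0:ℝ) 1) := by
      have hswap : ContinuousOn (fun p : ℝ × ℝ => c23 p.2 p.1)
          (Set.Icc (0:ℝ) 1 ×ˢ Set.Icc (0:ℝ) 1) :=
        h23cont.comp continuous_swap.continuousOn fun p hp => ⟨hp.2, hp.1⟩
      simp only [hF32]
      exact (continuousOn_parametric_primitive (c := fun t x => c23 x t) hswap).comp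
        (f := fun p : ℝ × ℝ => (x3, p.2)) (by fun_prop) fun p hp => ⟨hx3, hp.2⟩
    have hc23cont : ContinuousOn (fun p : ℝ × ℝ => c23 p.2 x3)
        (Set.Icc (0:ℝ) 1 ×ˢ Set.Icc (0:ℝ) 1) :=
      (h23cont.section_left hx3).comp continuous_snd.continuousOn fun p hp => hp.2
    have hc132cont : ContinuousOn (fun p : ℝ × ℝ => c132 (F12 p.1 p.2) (F32 x3 p.2) p.2)
        (Set.Icc (0:ℝ) 1 ×ˢ Set.Icc (0:ℝ) 1) :=
      h132cont.comp (f := fun p : ℝ × ℝ => (F12 p.1 p.2, F32 x3 p.2, p.2))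
        (hF12cont.prodMk (hF32cont.prodMk continuous_snd.continuousOn))
        fun p hp => ⟨hF12mem _ hp.1 _ hp.2, hF32mem _ hx3 _ hp.2, hp.2⟩
    have hfcont : ContinuousOn (Function.uncurry fun x1 x2 => f x1 x2 x3)
        (Set.Icc (0:ℝ) 1 ×ˢ Set.Icc (0:ℝ) 1) :=
      ((h12cont.mul hc23cont).mul hc132cont).congr fun p _ => hf p.1 p.2 x3
    rw [intervalIntegral_intervalIntegral_swap]
    · exact (intervalIntegral.integral_congr fun x2 hx2 =>
        hint1 x3 hx3 x2 (huIcc ▸ hx2)).trans (h23int' x3 hx3)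
    · refine (hfcont.integrableOn_compact (isCompact_Icc.prod isCompact_Icc)).mono_set ?_
      rw [Set.uIoc_of_le zero_le_one]
      exact Set.prod_mono Set.Ioc_subset_Icc_self Set.Ioc_subset_Icc_self
end

section
/- Let f : [0,1]³ → ℝ be a continuous strictly positive probability density with univariate marginal densities f₁, f₂, f₃, bivariate marginal densities f₁₂(x₁,x₂) = ∫₀¹ f(x₁,x₂,t) dt and f₂₃(x₂,x₃) = ∫₀¹ f(t,x₂,x₃) dt, marginal CDFs F_i(x) = ∫₀ˣ f_i, and conditional CDFs F_{1|2}(x₁|x₂) = (∫₀^{x₁} f₁₂(t,x₂) dt)/f₂(x₂) and F_{3|2}(x₃|x₂) = (∫₀^{x₃} f₂₃(x₂,t) dt)/f₂(x₂). Then there exist copula densities c₁₂, c₂₃ on [0,1]² and a continuous function c₁₃|₂ : [0,1]² × [0,1] → ℝ such that (u,w) ↦ c₁₃|₂(u,w,x₂) is a copula density for every x₂, and f(x₁,x₂,x₃) = f₁(x₁)f₂(x₂)f₃(x₃) · c₁₂(F₁(x₁),F₂(x₂)) · c₂₃(F₂(x₂),F₃(x₃)) · c₁₃|₂(F_{1|2}(x₁|x₂),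 F_{3|2}(x₃|x₂), x₂) for all (x₁,x₂,x₃) ∈ [0,1]³. -/
open MeasureTheory

open Set

/-- Fubini on `[0,1]²` for continuous functions. -/
lemma integral_unitInterval_swap {k : ℝ → ℝ → ℝ} (hk : Continuous fun p : ℝ × ℝ => k p.1 p.2) :
    ∫ x in (0:ℝ)..1, ∫ y in (0:ℝ)..1, k x y = ∫ y in (0:ℝ)..1, ∫ x in (0:ℝ)..1, k x y := by
  apply intervalIntegral_intervalIntegral_swap
  have h : IntegrableOn (Function.uncurry k) (uIcc (0:ℝ) 1 ×ˢ uIcc (0:ℝ) 1) :=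
    ContinuousOn.integrableOn_compact (isCompact_uIcc.prod isCompact_uIcc) hk.continuousOn
  exact h.mono_set (prod_mono uIoc_subset_uIcc uIoc_subset_uIcc)

lemma continuous_marginal {X : Type*} [TopologicalSpace X] [FirstCountableTopology X]
    {k : X → ℝ → ℝ} (hk : Continuous fun p : X × ℝ => k p.1 p.2) :
    Continuous fun x => ∫ t in (0:ℝ)..1, k x t :=
  intervalIntegral.continuous_parametric_intervalIntegral_of_continuous' hk 0 1

lemma integral_unitInterval_pos {φ : ℝ → ℝ} (hφ : Continuous φ) (hpos : ∀ x, 0 < φ x) :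
    0 < ∫ t in (0:ℝ)..1, φ t :=
  intervalIntegral.intervalIntegral_pos_of_pos (hφ.intervalIntegrable _ _) hpos zero_lt_one

/-- A continuous family of positive probability densities on `[0,1]` has a jointly continuous
family of quantile functions, and these satisfy the change of variables formula. -/
lemma exists_continuous_quantile {Y : Type*} [TopologicalSpace Y] [FirstCountableTopology Y]
    {h : ℝ → Y → ℝ} (hc : Continuous fun p : ℝ × Y => h p.1 p.2) (hpos : ∀ x y, 0 < h x y)
    (hone : ∀ y, ∫ t in (0:ℝ)..1, h t y = 1) :
    ∃ G : ℝ → Y → ℝ, Continuous (fun p : ℝ × Y => G p.1 p.2) ∧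
      (∀ x ∈ Icc (0:ℝ) 1, ∀ y, G (∫ t in (0:ℝ)..x, h t y) y = x) ∧
      ∀ y, ∀ φ : ℝ → ℝ, Continuous φ →
        ∫ u in (0:ℝ)..1, φ (G u y) = ∫ x in (0:ℝ)..1, φ x * h x y := by
  have hcy : ∀ y, Continuous fun t => h t y := fun y =>
    hc.comp (f := fun t => (t, y)) (by fun_prop)
  set F : ℝ → Y → ℝ := fun x y => ∫ t in (0:ℝ)..x, h t y with hF
  have hFcont : ∀ x, Continuous (F x) := fun x =>
    intervalIntegral.continuous_parametric_intervalIntegral_of_continuous'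
      (f := fun y t => h t y) (hc.comp continuous_swap) 0 x
  have hFderiv : ∀ x y, HasDerivAt (fun x => F x y) (h x y) x := fun x y =>
    intervalIntegral.integral_hasDerivAt_right ((hcy y).intervalIntegrable _ _)
      ((hcy y).stronglyMeasurableAtFilter _ _) (hcy y).continuousAt
  have hFx : ∀ y, Continuous fun x => F x y := fun y =>
    continuous_iff_continuousAt.2 fun x => (hFderiv x y).continuousAt
  have hFmono : ∀ y, StrictMono fun x => F x y := fun y =>
    strictMono_of_hasDerivAt_pos (fun x => hFderiv x y) fun x => hpos x y
  have hF0 : ∀ y, F 0 y = 0 := fun y => by simp [hF]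
  have hF1 : ∀ y, F 1 y = 1 := hone
  have hex : ∀ (u : Icc (0:ℝ) 1) y, ∃ x ∈ Icc (0:ℝ) 1, F x y = u := fun u y => by
    have := intermediate_value_Icc zero_le_one (hFx y).continuousOn
    simp only [hF0, hF1] at this
    exact this u.2
  choose Q hQmem hFQ using hex
  set G : ℝ → Y → ℝ := fun u y => Q (projIcc 0 1 zero_le_one u) y with hG
  have hGcont : Continuous fun p : ℝ × Y => G p.1 p.2 := by
    have hproj : Continuous fun p : ℝ × Y => (projIcc (0:ℝ) 1 zero_le_one p.1 : ℝ) :=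
      continuous_subtype_val.comp (continuous_projIcc.comp continuous_fst)
    refine continuous_iff_continuousAt.2 fun p => tendsto_order.2 ⟨fun a ha => ?_, fun a ha => ?_⟩
    · have hlt : F a p.2 < (projIcc (0:ℝ) 1 zero_le_one p.1 : ℝ) := by
        rw [← hFQ _ p.2]; exact hFmono p.2 ha
      filter_upwards [((hFcont a).comp continuous_snd).continuousAt.eventually_lt
        hproj.continuousAt hlt] with q hq
      rw [← hFQ _ q.2] at hq
      exact (hFmono q.2).lt_iff_lt.1 hq
    · have hlt : (projIcc (0:ℝ) 1 zero_le_one p.1 : ℝ) < F a p.2 := by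
        rw [← hFQ _ p.2]; exact hFmono p.2 ha
      filter_upwards [hproj.continuousAt.eventually_lt
        ((hFcont a).comp continuous_snd).continuousAt hlt] with q hq
      rw [← hFQ _ q.2] at hq
      exact (hFmono q.2).lt_iff_lt.1 hq
  have hGF : ∀ x ∈ Icc (0:ℝ) 1, ∀ y, G (F x y) y = x := fun x hx y => by
    have hmem : F x y ∈ Icc (0:ℝ) 1 :=
      ⟨(hF0 y).symm.trans_le ((hFmono y).monotone hx.1),
        ((hFmono y).monotone hx.2).trans_eq (hF1 y)⟩
    apply (hFmono y).injective
    simp only [hG, hFQ, projIcc_of_mem zero_le_one hmem]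
  refine ⟨G, hGcont, hGF, fun y φ hφ => ?_⟩
  have hsub := intervalIntegral.integral_comp_mul_deriv (a := 0) (b := 1)
    (fun x _ => hFderiv x y) (hcy y).continuousOn
    (g := fun u => φ (G u y))
    (hφ.comp (hGcont.comp (f := fun u => (u, y)) (by fun_prop)))
  rw [hF0, hF1] at hsub
  rw [← hsub]
  refine intervalIntegral.integral_congr fun x hx => ?_
  rw [uIcc_of_le zero_le_one] at hx
  simp only [Function.comp, hGF x hx y]

/-- Sklar's theorem for a continuous family of positive continuous bivariate densities on
`[0,1]²`, with the copula densities depending continuously on the parameter. -/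
lemma exists_continuous_copulaDensity {Y : Type*} [TopologicalSpace Y] [FirstCountableTopology Y]
    {k : ℝ → ℝ → Y → ℝ} (hk : Continuous fun p : ℝ × ℝ × Y => k p.1 p.2.1 p.2.2)
    (hpos : ∀ x z y, 0 < k x z y)
    (hone : ∀ y, ∫ x in (0:ℝ)..1, ∫ z in (0:ℝ)..1, k x z y = 1)
    {a b : ℝ → Y → ℝ} (ha : ∀ x y, a x y = ∫ z in (0:ℝ)..1, k x z y)
    (hb : ∀ z y, b z y = ∫ x in (0:ℝ)..1, k x z y) :
    ∃ c : ℝ → ℝ → Y → ℝ, Continuous (fun p : ℝ × ℝ × Y => c p.1 p.2.1 p.2.2) ∧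
      (∀ y, IsCopulaDensity fun u w => c u w y) ∧
      ∀ x ∈ Icc (0:ℝ) 1, ∀ z ∈ Icc (0:ℝ) 1, ∀ y,
        k x z y = a x y * b z y * c (∫ t in (0:ℝ)..x, a t y) (∫ t in (0:ℝ)..z, b t y) y := by
  have hac : Continuous fun p : ℝ × Y => a p.1 p.2 := by
    simp only [ha]
    exact continuous_marginal (k := fun (p : ℝ × Y) t => k p.1 t p.2)
      (hk.comp (f := fun p : (ℝ × Y) × ℝ => (p.1.1, p.2, p.1.2)) (by fun_prop))
  have hbc : Continuous fun p : ℝ × Y => b p.1 p.2 := by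
    simp only [hb]
    exact continuous_marginal (k := fun (p : ℝ × Y) t => k t p.1 p.2)
      (hk.comp (f := fun p : (ℝ × Y) × ℝ => (p.2, p.1.1, p.1.2)) (by fun_prop))
  have hapos : ∀ x y, 0 < a x y := fun x y => by
    rw [ha]
    exact integral_unitInterval_pos
      (hk.comp (f := fun z => (x, z, y)) (by fun_prop)) fun z => hpos x z y
  have hbpos : ∀ z y, 0 < b z y := fun z y => by
    rw [hb]
    exact integral_unitInterval_pos (φ := fun x => k x z y)
      (hk.comp (f := fun x => (x, z, y)) (by fun_prop))
      fun x => hpos x z y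
  have haone : ∀ y, ∫ x in (0:ℝ)..1, a x y = 1 := fun y => by simp only [ha, hone]
  have hbone : ∀ y, ∫ z in (0:ℝ)..1, b z y = 1 := fun y => by
    simp only [hb]
    refine Eq.trans ?_ (hone y)
    exact (integral_unitInterval_swap (k := fun x z => k x z y)
      (hk.comp (f := fun p : ℝ × ℝ => (p.1, p.2, y)) (by fun_prop))).symm
  obtain ⟨A, hAc, hA, hAint⟩ := exists_continuous_quantile hac hapos haone
  obtain ⟨B, hBc, hB, hBint⟩ := exists_continuous_quantile hbc hbpos hbone
  have hcc : Continuous fun p : ℝ × ℝ × Y => k (A p.1 p.2.2) (B p.2.1 p.2.2) p.2.2 /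
      (a (A p.1 p.2.2) p.2.2 * b (B p.2.1 p.2.2) p.2.2) := by
    have hA' : Continuous fun p : ℝ × ℝ × Y => A p.1 p.2.2 :=
      hAc.comp (f := fun p : ℝ × ℝ × Y => (p.1, p.2.2)) (by fun_prop)
    have hB' : Continuous fun p : ℝ × ℝ × Y => B p.2.1 p.2.2 := hBc.comp continuous_snd
    have hy : Continuous fun p : ℝ × ℝ × Y => p.2.2 := by fun_prop
    exact (hk.comp (hA'.prodMk (hB'.prodMk hy))).div
      ((hac.comp (hA'.prodMk hy)).mul (hbc.comp (hB'.prodMk hy)))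
      fun p => (mul_pos (hapos _ _) (hbpos _ _)).ne'
  refine ⟨fun u w y => k (A u y) (B w y) y / (a (A u y) y * b (B w y) y), hcc, fun y =>
    ⟨?_, ?_, ?_, ?_⟩, fun x hx z hz y => ?_⟩
  · exact (hcc.comp (f := fun p : ℝ × ℝ => (p.1, p.2, y)) (by fun_prop)).continuousOn
  · exact fun u _ w _ => (div_pos (hpos _ _ _) (mul_pos (hapos _ _) (hbpos _ _))).le
  · intro u _
    have hφ : Continuous fun z => k (A u y) z y / (a (A u y) y * b z y) :=
      (hk.comp (f := fun z => (A u y, z, y)) (by fun_prop)).div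
        (continuous_const.mul (hbc.comp (f := fun z => (z, y)) (by fun_prop)))
        fun z => (mul_pos (hapos _ _) (hbpos _ _)).ne'
    refine (hBint y _ hφ).trans ?_
    have : ∀ z, k (A u y) z y / (a (A u y) y * b z y) * b z y = k (A u y) z y / a (A u y) y :=
      fun z => by
        have := (hapos (A u y) y).ne'
        have := (hbpos z y).ne'
        field_simp
    simp only [this, intervalIntegral.integral_div, ← ha]
    exact div_self (hapos _ _).ne'
  · intro w _
    have hφ : Continuous fun x => k x (B w y) y / (a x y * b (B w y) y) :=
      (hk.comp (f := fun x => (x, B w y, y)) (by fun_prop)).div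
        ((hac.comp (f := fun x => (x, y)) (by fun_prop)).mul continuous_const)
        fun z => (mul_pos (hapos _ _) (hbpos _ _)).ne'
    refine (hAint y _ hφ).trans ?_
    have : ∀ x, k x (B w y) y / (a x y * b (B w y) y) * a x y = k x (B w y) y / b (B w y) y :=
      fun x => by
        have := (hapos x y).ne'
        have := (hbpos (B w y) y).ne'
        field_simp
    simp only [this, intervalIntegral.integral_div, ← hb]
    exact div_self (hbpos _ _).ne'
  · simp only [hA x hx y, hB z hz y]
    have := (hapos x y).ne'
    have := (hbpos z y).ne'
    field_simp

/-- The D-vine decomposition for a positive density continuous on all of `ℝ³`. -/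
lemma exists_vine_decomposition_of_continuous {g : ℝ → ℝ → ℝ → ℝ}
    (hg : Continuous fun p : ℝ × ℝ × ℝ => g p.1 p.2.1 p.2.2) (hpos : ∀ x y z, 0 < g x y z)
    (htotal : ∫ x in (0:ℝ)..1, ∫ y in (0:ℝ)..1, ∫ z in (0:ℝ)..1, g x y z = 1)
    {g1 g2 g3 : ℝ → ℝ} {g12 g23 : ℝ → ℝ → ℝ}
    (hg1 : ∀ x, g1 x = ∫ s in (0:ℝ)..1, ∫ t in (0:ℝ)..1, g x s t)
    (hg2 : ∀ y, g2 y = ∫ s in (0:ℝ)..1, ∫ t in (0:ℝ)..1, g s y t)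
    (hg3 : ∀ z, g3 z = ∫ s in (0:ℝ)..1, ∫ t in (0:ℝ)..1, g s t z)
    (hg12 : ∀ x y, g12 x y = ∫ t in (0:ℝ)..1, g x y t)
    (hg23 : ∀ y z, g23 y z = ∫ t in (0:ℝ)..1, g t y z) :
    ∃ c12 c23 : ℝ → ℝ → ℝ, ∃ c132 : ℝ → ℝ → ℝ → ℝ,
      IsCopulaDensity c12 ∧ IsCopulaDensity c23 ∧
      Continuous (fun p : ℝ × ℝ × ℝ => c132 p.1 p.2.1 p.2.2) ∧
      (∀ y, IsCopulaDensity (fun u w => c132 u w y)) ∧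
      ∀ x ∈ Icc (0:ℝ) 1, ∀ y ∈ Icc (0:ℝ) 1, ∀ z ∈ Icc (0:ℝ) 1,
        g x y z = g1 x * g2 y * g3 z
          * c12 (∫ t in (0:ℝ)..x, g1 t) (∫ t in (0:ℝ)..y, g2 t)
          * c23 (∫ t in (0:ℝ)..y, g2 t) (∫ t in (0:ℝ)..z, g3 t)
          * c132 ((∫ t in (0:ℝ)..x, g12 t y) / g2 y) ((∫ t in (0:ℝ)..z, g23 y t) / g2 y) y := by
  have hg12c : Continuous fun p : ℝ × ℝ => g12 p.1 p.2 := by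
    simp only [hg12]
    exact continuous_marginal (k := fun (p : ℝ × ℝ) t => g p.1 p.2 t)
      (hg.comp (f := fun p : (ℝ × ℝ) × ℝ => (p.1.1, p.1.2, p.2)) (by fun_prop))
  have hg23c : Continuous fun p : ℝ × ℝ => g23 p.1 p.2 := by
    simp only [hg23]
    exact continuous_marginal (k := fun (p : ℝ × ℝ) t => g t p.1 p.2)
      (hg.comp (f := fun p : (ℝ × ℝ) × ℝ => (p.2, p.1.1, p.1.2)) (by fun_prop))
  have hg12pos : ∀ x y, 0 < g12 x y := fun x y => by
    rw [hg12]
    exact integral_unitInterval_pos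
      (hg.comp (f := fun z => (x, y, z)) (by fun_prop)) (hpos x y)
  have hg23pos : ∀ y z, 0 < g23 y z := fun y z => by
    rw [hg23]
    exact integral_unitInterval_pos (φ := fun x => g x y z)
      (hg.comp (f := fun x => (x, y, z)) (by fun_prop))
      fun x => hpos x y z
  have hg1' : ∀ x, g1 x = ∫ y in (0:ℝ)..1, g12 x y := fun x => by simp only [hg1, hg12]
  have hg2' : ∀ y, g2 y = ∫ x in (0:ℝ)..1, g12 x y := fun y => by simp only [hg2, hg12]
  have hg2'' : ∀ y, g2 y = ∫ z in (0:ℝ)..1, g23 y z := fun y => by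
    simp only [hg2, hg23]
    exact integral_unitInterval_swap (k := fun x z => g x y z)
      (hg.comp (f := fun p : ℝ × ℝ => (p.1, y, p.2)) (by fun_prop))
  have hg3' : ∀ z, g3 z = ∫ y in (0:ℝ)..1, g23 y z := fun z => by
    simp only [hg3, hg23]
    exact integral_unitInterval_swap (k := fun x y => g x y z)
      (hg.comp (f := fun p : ℝ × ℝ => (p.1, p.2, z)) (by fun_prop))
  have hg2c : Continuous g2 := by
    rw [funext hg2']
    exact continuous_marginal (k := fun y x => g12 x y) (hg12c.comp continuous_swap)
  have hg2pos : ∀ y, 0 < g2 y := fun y => by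
    rw [hg2']
    exact integral_unitInterval_pos (φ := fun x => g12 x y)
      (hg12c.comp (f := fun x => (x, y)) (by fun_prop))
      fun x => hg12pos x y
  have htotal12 : ∫ x in (0:ℝ)..1, ∫ y in (0:ℝ)..1, g12 x y = 1 := by
    simp only [hg12, htotal]
  have htotal23 : ∫ y in (0:ℝ)..1, ∫ z in (0:ℝ)..1, g23 y z = 1 := by
    simp only [← hg2'']
    simp only [hg2']
    exact (integral_unitInterval_swap hg12c).symm.trans htotal12
  obtain ⟨c12, -, hc12, h12⟩ := exists_continuous_copulaDensity (Y := Unit)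
    (k := fun x y _ => g12 x y)
      (hg12c.comp (f := fun p : ℝ × ℝ × Unit => (p.1, p.2.1)) (by fun_prop)) (fun x y _ => hg12pos x y)
    (fun _ => htotal12) (a := fun x _ => g1 x) (b := fun y _ => g2 y)
    (fun x _ => hg1' x) (fun y _ => hg2' y)
  obtain ⟨c23, -, hc23, h23⟩ := exists_continuous_copulaDensity (Y := Unit)
    (k := fun y z _ => g23 y z)
      (hg23c.comp (f := fun p : ℝ × ℝ × Unit => (p.1, p.2.1)) (by fun_prop)) (fun y z _ => hg23pos y z)
    (fun _ => htotal23) (a := fun y _ => g2 y) (b := fun z _ => g3 z)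
    (fun y _ => hg2'' y) (fun z _ => hg3' z)
  obtain ⟨c132, hc132c, hc132, h132⟩ := exists_continuous_copulaDensity (Y := ℝ)
    (k := fun x z y => g x y z / g2 y)
    ((hg.comp (f := fun p : ℝ × ℝ × ℝ => (p.1, p.2.2, p.2.1)) (by fun_prop)).div
      (hg2c.comp (by fun_prop)) fun p => (hg2pos p.2.2).ne')
    (fun x z y => div_pos (hpos x y z) (hg2pos y))
    (fun y => by
      simp only [intervalIntegral.integral_div, ← hg2]
      exact div_self (hg2pos y).ne')
    (a := fun x y => g12 x y / g2 y) (b := fun z y => g23 y z / g2 y)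
    (fun x y => by simp only [intervalIntegral.integral_div, hg12])
    (fun z y => by simp only [intervalIntegral.integral_div, hg23])
  refine ⟨fun u v => c12 u v (), fun u v => c23 u v (), c132, hc12 (), hc23 (), hc132c, hc132,
    fun x hx y hy z hz => ?_⟩
  have e12 := h12 x hx y hy ()
  have e23 := h23 y hy z hz ()
  have e132 := h132 x hx z hz y
  simp only [intervalIntegral.integral_div] at e12 e23 e132
  have hne := (hg2pos y).ne'
  rw [div_eq_iff hne] at e132
  rw [e132, e12, e23]
  field_simp

lemma integral_congr_of_unitInterval {φ ψ : ℝ → ℝ} (h : ∀ t ∈ Icc (0:ℝ) 1, φ t = ψ t) {x : ℝ}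
    (hx : x ∈ Icc (0:ℝ) 1) : ∫ t in (0:ℝ)..x, φ t = ∫ t in (0:ℝ)..x, ψ t :=
  intervalIntegral.integral_congr fun t ht => by
    rw [uIcc_of_le hx.1] at ht
    exact h t ⟨ht.1, ht.2.trans hx.2⟩

/-- **D-vine decomposition of a trivariate density.** A continuous strictly positive
probability density `f` on `[0,1]³` factors along the three-variable D-vine: there are copula
densities `c₁₂`, `c₂₃` and a continuous family of copula densities `c₁₃|₂ (·,·,x₂)` with
`f x₁ x₂ x₃ = f₁ x₁ * f₂ x₂ * f₃ x₃ * c₁₂ (F₁ x₁) (F₂ x₂) * c₂₃ (F₂ x₂) (F₃ x₃) *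
  c₁₃|₂ (F₁|₂ (x₁|x₂)) (F₃|₂ (x₃|x₂)) x₂`. -/
theorem three_var_vine_decomposition (f : ℝ → ℝ → ℝ → ℝ)
    (hfcont : ContinuousOn (fun p : ℝ × ℝ × ℝ => f p.1 p.2.1 p.2.2)
      ((Set.Icc (0:ℝ) 1) ×ˢ ((Set.Icc (0:ℝ) 1) ×ˢ (Set.Icc (0:ℝ) 1))))
    (hfpos : ∀ x1 ∈ Set.Icc (0:ℝ) 1, ∀ x2 ∈ Set.Icc (0:ℝ) 1, ∀ x3 ∈ Set.Icc (0:ℝ) 1,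
      0 < f x1 x2 x3)
    (hftotal : (∫ x1 in (0:ℝ)..1, ∫ x2 in (0:ℝ)..1, ∫ x3 in (0:ℝ)..1, f x1 x2 x3) = 1)
    (f1 f2 f3 : ℝ → ℝ) (f12 f23 : ℝ → ℝ → ℝ)
    (hf1 : ∀ x1, f1 x1 = ∫ s in (0:ℝ)..1, ∫ t in (0:ℝ)..1, f x1 s t)
    (hf2 : ∀ x2, f2 x2 = ∫ s in (0:ℝ)..1, ∫ t in (0:ℝ)..1, f s x2 t)
    (hf3 : ∀ x3, f3 x3 = ∫ s in (0:ℝ)..1, ∫ t in (0:ℝ)..1, f s t x3)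
    (hf12 : ∀ x1 x2, f12 x1 x2 = ∫ t in (0:ℝ)..1, f x1 x2 t)
    (hf23 : ∀ x2 x3, f23 x2 x3 = ∫ t in (0:ℝ)..1, f t x2 x3)
    (F1 F2 F3 : ℝ → ℝ)
    (hF1 : ∀ x, F1 x = ∫ t in (0:ℝ)..x, f1 t)
    (hF2 : ∀ x, F2 x = ∫ t in (0:ℝ)..x, f2 t)
    (hF3 : ∀ x, F3 x = ∫ t in (0:ℝ)..x, f3 t)
    (F12 F32 : ℝ → ℝ → ℝ)
    (hF12 : ∀ x1 x2, F12 x1 x2 = (∫ t in (0:ℝ)..x1, f12 t x2) / f2 x2)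
    (hF32 : ∀ x3 x2, F32 x3 x2 = (∫ t in (0:ℝ)..x3, f23 x2 t) / f2 x2) :
    ∃ c12 c23 : ℝ → ℝ → ℝ, ∃ c132 : ℝ → ℝ → ℝ → ℝ,
      IsCopulaDensity c12 ∧ IsCopulaDensity c23 ∧
      ContinuousOn (fun p : ℝ × ℝ × ℝ => c132 p.1 p.2.1 p.2.2)
        ((Set.Icc (0:ℝ) 1) ×ˢ ((Set.Icc (0:ℝ) 1) ×ˢ (Set.Icc (0:ℝ) 1))) ∧
      (∀ x2 ∈ Set.Icc (0:ℝ) 1, IsCopulaDensity (fun u w => c132 u w x2)) ∧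
      ∀ x1 ∈ Set.Icc (0:ℝ) 1, ∀ x2 ∈ Set.Icc (0:ℝ) 1, ∀ x3 ∈ Set.Icc (0:ℝ) 1,
        f x1 x2 x3 = f1 x1 * f2 x2 * f3 x3 * c12 (F1 x1) (F2 x2) * c23 (F2 x2) (F3 x3)
          * c132 (F12 x1 x2) (F32 x3 x2) x2 := by
  set r : ℝ → ℝ := fun x => projIcc (0:ℝ) 1 zero_le_one x with hr
  have hrc : Continuous r := continuous_subtype_val.comp continuous_projIcc
  have hrmem : ∀ x, r x ∈ Icc (0:ℝ) 1 := fun x => (projIcc (0:ℝ) 1 zero_le_one x).2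
  have hrid : ∀ x ∈ Icc (0:ℝ) 1, r x = x := fun x hx => by
    simp only [hr, projIcc_of_mem zero_le_one hx]
  have hone : (1:ℝ) ∈ Icc (0:ℝ) 1 := right_mem_Icc.2 zero_le_one
  set g : ℝ → ℝ → ℝ → ℝ := fun x y z => f (r x) (r y) (r z) with hg
  have hgc : Continuous fun p : ℝ × ℝ × ℝ => g p.1 p.2.1 p.2.2 :=
    hfcont.comp_continuous (f := fun p : ℝ × ℝ × ℝ => (r p.1, r p.2.1, r p.2.2)) (by fun_prop)
      fun p => ⟨hrmem _, hrmem _, hrmem _⟩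
  have hfg : ∀ x ∈ Icc (0:ℝ) 1, ∀ y ∈ Icc (0:ℝ) 1, ∀ z ∈ Icc (0:ℝ) 1, f x y z = g x y z :=
    fun x hx y hy z hz => by simp only [hg, hrid x hx, hrid y hy, hrid z hz]
  have h12 : ∀ x ∈ Icc (0:ℝ) 1, ∀ y ∈ Icc (0:ℝ) 1, f12 x y = ∫ t in (0:ℝ)..1, g x y t :=
    fun x hx y hy => (hf12 x y).trans (integral_congr_of_unitInterval (hfg x hx y hy) hone)
  have h23 : ∀ y ∈ Icc (0:ℝ) 1, ∀ z ∈ Icc (0:ℝ) 1, f23 y z = ∫ t in (0:ℝ)..1, g t y z :=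
    fun y hy z hz => (hf23 y z).trans
      (integral_congr_of_unitInterval (fun t ht => hfg t ht y hy z hz) hone)
  have h1 : ∀ x ∈ Icc (0:ℝ) 1, f1 x = ∫ s in (0:ℝ)..1, ∫ t in (0:ℝ)..1, g x s t :=
    fun x hx => (hf1 x).trans (integral_congr_of_unitInterval (fun s hs =>
      integral_congr_of_unitInterval (hfg x hx s hs) hone) hone)
  have h2 : ∀ y ∈ Icc (0:ℝ) 1, f2 y = ∫ s in (0:ℝ)..1, ∫ t in (0:ℝ)..1, g s y t :=
    fun y hy => (hf2 y).trans (integral_congr_of_unitInterval (fun s hs =>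
      integral_congr_of_unitInterval (hfg s hs y hy) hone) hone)
  have h3 : ∀ z ∈ Icc (0:ℝ) 1, f3 z = ∫ s in (0:ℝ)..1, ∫ t in (0:ℝ)..1, g s t z :=
    fun z hz => (hf3 z).trans (integral_congr_of_unitInterval (fun s hs =>
      integral_congr_of_unitInterval (fun t ht => hfg s hs t ht z hz) hone) hone)
  have htotal : ∫ x in (0:ℝ)..1, ∫ y in (0:ℝ)..1, ∫ z in (0:ℝ)..1, g x y z = 1 := by
    refine Eq.trans ?_ hftotal
    exact integral_congr_of_unitInterval (fun x hx => (h1 x hx).symm.trans (hf1 x)) hone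
  obtain ⟨c12, c23, c132, hc12, hc23, hc132c, hc132, hdec⟩ :=
    exists_vine_decomposition_of_continuous hgc
      (fun x y z => hfpos _ (hrmem x) _ (hrmem y) _ (hrmem z)) htotal
      (fun _ => rfl) (fun _ => rfl) (fun _ => rfl) (fun _ _ => rfl) (fun _ _ => rfl)
  refine ⟨c12, c23, c132, hc12, hc23, hc132c.continuousOn, fun y _ => hc132 y,
    fun x hx y hy z hz => ?_⟩
  rw [hF1, hF2, hF3, hF12, hF32, integral_congr_of_unitInterval h1 hx,
    integral_congr_of_unitInterval h2 hy, integral_congr_of_unitInterval h3 hz,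
    integral_congr_of_unitInterval (fun t ht => h12 t ht y hy) hx,
    integral_congr_of_unitInterval (fun t ht => h23 y hy t ht) hz,
    h1 x hx, h2 y hy, h3 z hz, hfg x hx y hy z hz]
  exact hdec x hx y hy z hz
end

section
/- Let r ≥ 0 and let φ⁰, φ¹, …, φʳ be real polynomials with deg φⁱ = i that are orthonormal on [0,1] (∫₀¹ φⁱφᵏ = δ_{ik}). Then there exist functions ψ⁰, ψ¹, …, ψʳ : [0,1] → ℝ, each of which is given by a polynomial of degree at most r on [0, 1/2] and by a (possibly different) polynomial of degree at most r on [1/2, 1], satisfying the vanishing moment conditions ∫₀¹ ψⁱ(x)·xʲ dx = 0 for all i = 0,…,r and j = 0,…,i+r, and the orthonormality conditions ∫₀¹ ψⁱ(x)ψʲ(x) dx = δ_{ij} for all i,j = 0,…,r. -/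
open MeasureTheory

open Polynomial

/-- For a positive definite symmetric form on a space of dimension larger than `2 * r + 1`, and
linear functionals `ℓ 0, ℓ 1, …`, there are orthonormal vectors `v 0, …, v r` such that `v i` is
annihilated by `ℓ 0, …, ℓ (i + r)`. -/
theorem exists_orthonormal_apply_eq_zero {V : Type*} [AddCommGroup V] [Module ℝ V]
    [FiniteDimensional ℝ V] (B : V →ₗ[ℝ] V →ₗ[ℝ] ℝ) (hsymm : ∀ u v, B u v = B v u)
    (hpos : ∀ v, v ≠ 0 → 0 < B v v) (ℓ : ℕ → V →ₗ[ℝ] ℝ) (r : ℕ)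
    (hdim : 2 * r + 1 < Module.finrank ℝ V) :
    ∃ v : Fin (r + 1) → V,
      (∀ i : Fin (r + 1), ∀ j : ℕ, j ≤ (i : ℕ) + r → ℓ j (v i) = 0) ∧
      ∀ i j, B (v i) (v j) = if i = j then 1 else 0 := by
  -- The vectors are chosen in the order `v r, v (r - 1), …, v 0`.
  have key : ∀ k ≤ r + 1, ∃ χ : ℕ → V,
      (∀ m < k, ∀ j, j + m ≤ 2 * r → ℓ j (χ m) = 0) ∧
      ∀ m < k, ∀ n < k, B (χ m) (χ n) = if m = n then 1 else 0 := by
    intro k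
    induction k with
    | zero => exact fun _ => ⟨fun _ => 0, by simp, by simp⟩
    | succ k ih =>
      intro hk
      obtain ⟨χ, hχ, hχB⟩ := ih (by omega)
      let T : V →ₗ[ℝ] (Fin (2 * r + 1) → ℝ) :=
        LinearMap.pi fun i => if (i : ℕ) < k then B (χ i) else ℓ (i - k)
      have hT : LinearMap.ker T ≠ ⊥ := LinearMap.ker_ne_bot_of_finrank_lt (by simpa using hdim)
      obtain ⟨w, hw, hw0⟩ := (Submodule.ne_bot_iff _).1 hT
      have hwB : ∀ m < k, B (χ m) w = 0 := fun m hm => by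
        simpa [T, hm] using congrFun (LinearMap.mem_ker.1 hw) ⟨m, by omega⟩
      have hwℓ : ∀ j, j + k ≤ 2 * r → ℓ j w = 0 := fun j hj => by
        simpa [T] using congrFun (LinearMap.mem_ker.1 hw) ⟨j + k, by omega⟩
      have hww := hpos w hw0
      have hsq : √(B w w) * √(B w w) = B w w := Real.mul_self_sqrt hww.le
      have hne : √(B w w) ≠ 0 := (Real.sqrt_pos.2 hww).ne'
      refine ⟨Function.update χ k ((√(B w w))⁻¹ • w), ?_, ?_⟩
      · intro m hm j hj
        rcases eq_or_ne m k with rfl | hmk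
        · simp [hwℓ j hj]
        · simp [hmk, hχ m (by omega) j hj]
      · intro m hm n hn
        rcases eq_or_ne m k with rfl | hmk <;> rcases eq_or_ne n m with rfl | hnm
        · simp only [Function.update_self, map_smul, LinearMap.smul_apply, smul_eq_mul, if_true]
          field_simp
          rw [sq, hsq]
        · simp [hnm, hnm.symm, hsymm w, hwB n (by omega)]
        · simp [hmk, hχB n (by omega) n (by omega)]
        · rcases eq_or_ne n k with rfl | hnk
          · simp [hmk, hwB m (by omega)]
          · simp [hmk, hnk, hχB m (by omega) n (by omega)]
  obtain ⟨χ, hχ, hχB⟩ := key (r + 1) le_rfl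
  refine ⟨fun i => χ (r - i), fun i j hij => hχ _ (by omega) _ (by omega), fun i j => ?_⟩
  rw [hχB _ (by omega) _ (by omega)]
  exact if_congr (by rw [Fin.ext_iff]; omega) rfl rfl

/-- Integration of real polynomials over `[a, b]` as a linear functional. -/
noncomputable def polynomialIntegral (a b : ℝ) : ℝ[X] →ₗ[ℝ] ℝ where
  toFun p := ∫ x in a..b, p.eval x
  map_add' p q := by
    simp only [eval_add]
    exact intervalIntegral.integral_add (p.continuous.intervalIntegrable _ _)
      (q.continuous.intervalIntegrable _ _)
  map_smul' c p := by simp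

theorem polynomialIntegral_apply (a b : ℝ) (p : ℝ[X]) :
    polynomialIntegral a b p = ∫ x in a..b, p.eval x := rfl

theorem polynomialIntegral_mul_self_nonneg {a b : ℝ} (hab : a ≤ b) (p : ℝ[X]) :
    0 ≤ polynomialIntegral a b (p * p) :=
  intervalIntegral.integral_nonneg hab fun x _ => by
    rw [eval_mul]
    exact mul_self_nonneg _

theorem polynomialIntegral_mul_self_pos {a b : ℝ} (hab : a < b) {p : ℝ[X]} (hp : p ≠ 0) :
    0 < polynomialIntegral a b (p * p) := by
  obtain ⟨c, hc, hpc⟩ : ∃ c ∈ Set.Icc a b, p.eval c ≠ 0 := by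
    by_contra! h
    exact hp (eq_zero_of_infinite_isRoot p ((Set.Icc_infinite hab).mono h))
  refine intervalIntegral.integral_pos hab (p * p).continuous.continuousOn
    (fun x _ => ?_) ⟨c, hc, ?_⟩
  · rw [eval_mul]
    exact mul_self_nonneg _
  · rw [eval_mul]
    exact mul_self_pos.2 hpc

/-- The function equal to `p` to the left of `1 / 2` and to `q` from `1 / 2` on. -/
noncomputable def piecewiseEval (p q : ℝ[X]) (x : ℝ) : ℝ :=
  if x < 1 / 2 then p.eval x else q.eval x

theorem piecewiseEval_mul (p q p' q' : ℝ[X]) (x : ℝ) :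
    piecewiseEval p q x * piecewiseEval p' q' x = piecewiseEval (p * p') (q * q') x := by
  unfold piecewiseEval
  split_ifs <;> simp

theorem integral_piecewiseEval (p q : ℝ[X]) :
    ∫ x in (0 : ℝ)..1, piecewiseEval p q x =
      polynomialIntegral 0 (1 / 2) p + polynomialIntegral (1 / 2) 1 q := by
  have hl : Set.EqOn (fun x => p.eval x) (piecewiseEval p q) (Set.uIoo 0 (1 / 2)) := by
    intro x hx
    rw [Set.uIoo_of_le (by norm_num)] at hx
    exact (if_pos hx.2).symm
  have hr : Set.EqOn (fun x => q.eval x) (piecewiseEval p q) (Set.uIoo (1 / 2) 1) := by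
    intro x hx
    rw [Set.uIoo_of_le (by norm_num)] at hx
    exact (if_neg hx.1.le.not_gt).symm
  rw [← intervalIntegral.integral_add_adjacent_intervals
    ((p.continuous.intervalIntegrable _ _).congr_uIoo hl)
    ((q.continuous.intervalIntegrable _ _).congr_uIoo hr),
    polynomialIntegral_apply, polynomialIntegral_apply,
    intervalIntegral.integral_congr_uIoo hl, intervalIntegral.integral_congr_uIoo hr]

/-- The `L²` pairing of piecewise polynomials with a breakpoint at `1 / 2`. -/
noncomputable def piecewisePairing :
    (ℝ[X] × ℝ[X]) →ₗ[ℝ] (ℝ[X] × ℝ[X]) →ₗ[ℝ] ℝ :=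
  LinearMap.mk₂ ℝ
    (fun u v => polynomialIntegral 0 (1 / 2) (u.1 * v.1) +
      polynomialIntegral (1 / 2) 1 (u.2 * v.2))
    (fun u v w => by simp only [Prod.fst_add, Prod.snd_add, add_mul, map_add]; ring)
    (fun c u v => by
      simp only [Prod.smul_fst, Prod.smul_snd, smul_mul_assoc, map_smul, smul_add])
    (fun u v w => by simp only [Prod.fst_add, Prod.snd_add, mul_add, map_add]; ring)
    (fun c u v => by
      simp only [Prod.smul_fst, Prod.smul_snd, mul_smul_comm, map_smul, smul_add])

theorem piecewisePairing_apply (u v : ℝ[X] × ℝ[X]) :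
    piecewisePairing u v = polynomialIntegral 0 (1 / 2) (u.1 * v.1) +
      polynomialIntegral (1 / 2) 1 (u.2 * v.2) := rfl

theorem piecewisePairing_comm (u v : ℝ[X] × ℝ[X]) :
    piecewisePairing u v = piecewisePairing v u := by
  simp only [piecewisePairing_apply, mul_comm]

theorem piecewisePairing_self_pos {u : ℝ[X] × ℝ[X]} (hu : u ≠ 0) :
    0 < piecewisePairing u u := by
  rw [piecewisePairing_apply]
  by_cases h : u.1 = 0
  · have h2 : u.2 ≠ 0 := fun h2 => hu (Prod.ext h h2)
    exact add_pos_of_nonneg_of_pos (polynomialIntegral_mul_self_nonneg (by norm_num) _)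
      (polynomialIntegral_mul_self_pos (by norm_num) h2)
  · exact add_pos_of_pos_of_nonneg (polynomialIntegral_mul_self_pos (by norm_num) h)
      (polynomialIntegral_mul_self_nonneg (by norm_num) _)

theorem integral_piecewiseEval_mul (u v : ℝ[X] × ℝ[X]) :
    ∫ x in (0 : ℝ)..1, piecewiseEval u.1 u.2 x * piecewiseEval v.1 v.2 x =
      piecewisePairing u v := by
  simp only [piecewiseEval_mul, integral_piecewiseEval, piecewisePairing_apply]

theorem natDegree_le_of_mem_degreeLT {r : ℕ} {p : ℝ[X]} (hp : p ∈ degreeLT ℝ (r + 1)) :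
    p.natDegree ≤ r := by
  rw [mem_degreeLT, Nat.cast_succ] at hp
  exact natDegree_le_of_degree_le (Order.le_of_lt_succ hp)

/-- **Existence of Legendre multiwavelets.** Given the `r`-th order Legendre scaling
functions `φ⁰, …, φʳ` (orthonormal polynomials on `[0,1]` with `deg φⁱ = i`), there exist
wavelets `ψ⁰, …, ψʳ : [0,1] → ℝ`, each given piecewise by a polynomial of degree at most `r`
on the left half `[0, 1/2)` of the interval and by a (possibly different) polynomial of
degree at most `r` on the right half `[1/2, 1]`, satisfying the vanishing moment conditions
`∫₀¹ ψⁱ(x) xʲ dx = 0` for `j = 0, …, i + r` and the orthonormality conditions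
`∫₀¹ ψⁱ ψʲ = δᵢⱼ`. -/
theorem legendre_multiwavelets_exist (r : ℕ) (φ : Fin (r + 1) → Polynomial ℝ)
    (hdeg : ∀ i : Fin (r + 1), (φ i).natDegree = (i : ℕ))
    (horth : ∀ i k : Fin (r + 1),
      (∫ x in (0:ℝ)..1, (φ i).eval x * (φ k).eval x) = if i = k then 1 else 0) :
    ∃ ψ : Fin (r + 1) → ℝ → ℝ,
      (∀ i : Fin (r + 1), ∃ P Q : Polynomial ℝ, P.natDegree ≤ r ∧ Q.natDegree ≤ r ∧
        (∀ x ∈ Set.Ico (0:ℝ) (1/2), ψ i x = P.eval x) ∧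
        (∀ x ∈ Set.Icc (1/2:ℝ) 1, ψ i x = Q.eval x)) ∧
      (∀ i : Fin (r + 1), ∀ j : ℕ, j ≤ (i : ℕ) + r →
        (∫ x in (0:ℝ)..1, ψ i x * x ^ j) = 0) ∧
      (∀ i j : Fin (r + 1),
        (∫ x in (0:ℝ)..1, ψ i x * ψ j x) = if i = j then 1 else 0) := by

  have e := degreeLTEquiv ℝ (r + 1)
  have : FiniteDimensional ℝ (degreeLT ℝ (r + 1)) := e.symm.finiteDimensional
  let ι : (degreeLT ℝ (r + 1) × degreeLT ℝ (r + 1)) →ₗ[ℝ] ℝ[X] × ℝ[X] :=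
    (degreeLT ℝ (r + 1)).subtype.prodMap (degreeLT ℝ (r + 1)).subtype
  have hι : Function.Injective ι :=
    Prod.map_injective.2 ⟨Subtype.val_injective, Subtype.val_injective⟩
  obtain ⟨v, hv, hvB⟩ := exists_orthonormal_apply_eq_zero (piecewisePairing.compl₁₂ ι ι)
    (fun _ _ => piecewisePairing_comm _ _)
    (fun _ hu => piecewisePairing_self_pos ((map_ne_zero_iff ι hι).2 hu))
    (fun j => (piecewisePairing (X ^ j, X ^ j)).comp ι) r
    (by rw [Module.finrank_prod, e.finrank_eq, Module.finrank_fin_fun]; omega)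
  refine ⟨fun i => piecewiseEval (ι (v i)).1 (ι (v i)).2, fun i => ?_, fun i j hij => ?_,
    fun i j => ?_⟩
  · exact ⟨_, _, natDegree_le_of_mem_degreeLT (v i).1.2, natDegree_le_of_mem_degreeLT (v i).2.2,
      fun x hx => if_pos hx.2, fun x hx => if_neg hx.1.not_gt⟩
  · have hX : ∀ x : ℝ, x ^ j = piecewiseEval (X ^ j) (X ^ j) x := by simp [piecewiseEval]
    simp only [hX]
    rw [integral_piecewiseEval_mul _ (X ^ j, X ^ j), piecewisePairing_comm]
    exact hv i j hij
  · rw [integral_piecewiseEval_mul]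
    exact hvB i j
end
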